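/- arXiv:1709.08923 — 2 statements merged into one kernel-verified Lean document; each statement's English description precedes it below -/
import Mathlib

section
/- Fix ν > 0 and 0 < b < c. There exist a probability space carrying an inverse-gamma random variable Z (with parameter ν) and a random variable S with values in [0,1], independent of Z, such that (1 − Z/b)_+ and S·(1 − Z/c)_+ have the same distribution. -/
open MeasureTheory ProbabilityTheory Real Set

/-- Kummer's confluent hypergeometric function `Φ(α,β;z)`, via the Euler integral
`Φ(α,β;z) = (Γ(β)/(Γ(α)Γ(β−α))) ∫_0^1 t^{α−1}(1−t)^{β−α−1} e^{zt} dt`. -/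
noncomputable def Phi (α β z : ℝ) : ℝ :=
  (Real.Gamma β / (Real.Gamma α * Real.Gamma (β - α))) *
    ∫ t in Set.Ioo (0:ℝ) 1, t ^ (α - 1) * (1 - t) ^ (β - α - 1) * Real.exp (z * t)

/-- Tricomi's confluent hypergeometric function `Ψ(α,β;z)`, via the integral
`Ψ(α,β;z) = (1/Γ(α)) ∫_0^∞ e^{−zt} t^{α−1} (1+t)^{β−α−1} dt`. -/
noncomputable def Psi (α β z : ℝ) : ℝ :=
  (Real.Gamma α)⁻¹ *
    ∫ t in Set.Ioi (0:ℝ), Real.exp (-(z * t)) * t ^ (α - 1) * (1 + t) ^ (β - α - 1)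

/-- The inverse-gamma law with parameter `ν`: the pushforward of the `Gamma(ν,1)`
distribution under the map `x ↦ 1/(2x)`. -/
noncomputable def invGammaLaw (ν : ℝ) : Measure ℝ :=
  Measure.map (fun x => 1 / (2 * x)) (gammaMeasure ν 1)

/-- The linear functional on polynomials that sends `X ^ n` to `m n`. -/
noncomputable def momentFunctional (m : ℕ → ℝ) : Polynomial ℝ →ₗ[ℝ] ℝ :=
  Polynomial.lsum fun n => LinearMap.mulRight ℝ (m n)

lemma momentFunctional_apply (m : ℕ → ℝ) (p : Polynomial ℝ) :
    momentFunctional m p = ∑ n ∈ p.support, p.coeff n * m n := by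
  simp [momentFunctional, Polynomial.lsum, Polynomial.sum_def]

lemma momentFunctional_X_pow (m : ℕ → ℝ) (n : ℕ) :
    momentFunctional m (Polynomial.X ^ n) = m n := by
  rw [momentFunctional_apply, Polynomial.support_X_pow]
  simp

lemma momentFunctional_one (m : ℕ → ℝ) : momentFunctional m 1 = m 0 := by
  simpa using momentFunctional_X_pow m 0

/-- The Bernstein polynomial of degree `N` of the function `x ↦ x ^ j`. -/
noncomputable def bernsteinOfPow (N j : ℕ) : Polynomial ℝ :=
  ∑ k ∈ Finset.range (N + 1), ((k : ℝ) / N) ^ j • bernsteinPolynomial ℝ N k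

lemma bernsteinOfPow_zero (N : ℕ) : bernsteinOfPow N 0 = 1 := by
  simp [bernsteinOfPow, bernsteinPolynomial.sum]

lemma X_mul_derivative_X_pow (k : ℕ) :
    Polynomial.X * Polynomial.derivative ((Polynomial.X : Polynomial ℝ) ^ k)
      = (k : Polynomial ℝ) * Polynomial.X ^ k := by
  cases k with
  | zero => simp
  | succ k => simp [Polynomial.derivative_pow]; ring

lemma one_sub_X_mul_derivative_one_sub_X_pow (k : ℕ) :
    (1 - Polynomial.X) * Polynomial.derivative ((1 - Polynomial.X : Polynomial ℝ) ^ k)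
      = -((k : Polynomial ℝ) * (1 - Polynomial.X) ^ k) := by
  cases k with
  | zero => simp
  | succ k => simp [Polynomial.derivative_pow]; ring

lemma X_mul_one_sub_X_mul_derivative_bernsteinPolynomial {N k : ℕ} (hk : k ≤ N) :
    Polynomial.X * (1 - Polynomial.X) * Polynomial.derivative (bernsteinPolynomial ℝ N k)
      = ((k : Polynomial ℝ) - (N : Polynomial ℝ) * Polynomial.X) * bernsteinPolynomial ℝ N k := by
  have h1 := X_mul_derivative_X_pow k
  have h2 := one_sub_X_mul_derivative_one_sub_X_pow (N - k)
  have h3 : ((N - k : ℕ) : Polynomial ℝ) = (N : Polynomial ℝ) - k := by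
    push_cast [hk]; ring
  rw [h3] at h2
  rw [bernsteinPolynomial, Polynomial.derivative_mul, Polynomial.derivative_mul,
    Polynomial.derivative_natCast]
  linear_combination
    ((N.choose k : Polynomial ℝ) * (1 - Polynomial.X) * (1 - Polynomial.X) ^ (N - k)) * h1
    + ((N.choose k : Polynomial ℝ) * Polynomial.X * Polynomial.X ^ k) * h2

lemma bernsteinOfPow_succ {N : ℕ} (hN : N ≠ 0) (j : ℕ) :
    bernsteinOfPow N (j + 1) = Polynomial.X * bernsteinOfPow N j
      + (N : ℝ)⁻¹ • (Polynomial.X * (1 - Polynomial.X)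
          * Polynomial.derivative (bernsteinOfPow N j)) := by
  have hN' : (N : ℝ) ≠ 0 := by exact_mod_cast hN
  simp only [bernsteinOfPow, Polynomial.derivative_sum, Finset.mul_sum, Finset.smul_sum,
    ← Finset.sum_add_distrib, Polynomial.derivative_smul, mul_smul_comm]
  refine Finset.sum_congr rfl fun k hk => ?_
  rw [X_mul_one_sub_X_mul_derivative_bernsteinPolynomial (Finset.mem_range_succ_iff.mp hk)]
  have hNC : (Polynomial.C (N : ℝ)⁻¹) * (N : Polynomial ℝ) = 1 := by
    rw [← Polynomial.C_eq_natCast, ← Polynomial.C_mul, inv_mul_cancel₀ hN', Polynomial.C_1]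
  simp only [Polynomial.smul_eq_C_mul, div_eq_mul_inv, pow_succ, Polynomial.C_mul,
    Polynomial.C_pow, Polynomial.C_eq_natCast]
  linear_combination (-((k : Polynomial ℝ) * Polynomial.C (N : ℝ)⁻¹) ^ j * Polynomial.X
    * bernsteinPolynomial ℝ N k) * -hNC

lemma tendsto_apply_bernsteinOfPow (j : ℕ) (L : Polynomial ℝ →ₗ[ℝ] ℝ) :
    Filter.Tendsto (fun N => L (bernsteinOfPow N j)) Filter.atTop
      (nhds (L (Polynomial.X ^ j))) := by
  induction j generalizing L with
  | zero => simp [bernsteinOfPow_zero]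
  | succ j ih =>
    have h1 := ih (L ∘ₗ LinearMap.mulLeft ℝ Polynomial.X)
    have h2 := ih (L ∘ₗ LinearMap.mulLeft ℝ (Polynomial.X * (1 - Polynomial.X))
      ∘ₗ Polynomial.derivative)
    have h3 := h1.add ((tendsto_inv_atTop_nhds_zero_nat (𝕜 := ℝ)).mul h2)
    rw [zero_mul, add_zero] at h3
    simp only [LinearMap.comp_apply, LinearMap.mulLeft_apply, ← pow_succ'] at h3
    refine h3.congr' ?_
    filter_upwards [Filter.eventually_ne_atTop 0] with N hN
    rw [bernsteinOfPow_succ hN, map_add, map_smul, smul_eq_mul]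

/-- **Hausdorff moment problem**: a completely monotone sequence starting at `1` is the moment
sequence of a probability measure on the unit interval. -/
theorem exists_probabilityMeasure_integral_pow_eq (m : ℕ → ℝ) (h0 : m 0 = 1)
    (hm : ∀ n k, 0 ≤ momentFunctional m (Polynomial.X ^ n * (1 - Polynomial.X) ^ k)) :
    ∃ ρ : ProbabilityMeasure unitInterval,
      ∀ j : ℕ, ∫ x, (x : ℝ) ^ j ∂(ρ : Measure unitInterval) = m j := by
  have hb (N k : ℕ) : 0 ≤ momentFunctional m (bernsteinPolynomial ℝ N k) := by
    have : bernsteinPolynomial ℝ N k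
        = (N.choose k : ℝ) • (Polynomial.X ^ k * (1 - Polynomial.X) ^ (N - k)) := by
      rw [bernsteinPolynomial, Polynomial.smul_eq_C_mul, Polynomial.C_eq_natCast, mul_assoc]
    rw [this, map_smul, smul_eq_mul]
    exact mul_nonneg (Nat.cast_nonneg _) (hm _ _)
  have hsum (N : ℕ) : ∑ k ∈ Finset.range (N + 1),
      momentFunctional m (bernsteinPolynomial ℝ N k) = 1 := by
    rw [← map_sum, bernsteinPolynomial.sum, momentFunctional_one, h0]
  let μ (N : ℕ) : Measure unitInterval := ∑ k : Fin (N + 1),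
    ENNReal.ofReal (momentFunctional m (bernsteinPolynomial ℝ N k)) •
      Measure.dirac (bernstein.z k)
  have hμ (N : ℕ) : IsProbabilityMeasure (μ N) := by
    constructor
    simp only [μ, Measure.finsetSum_apply, Measure.smul_apply, measure_univ, smul_eq_mul, mul_one]
    rw [← ENNReal.ofReal_sum_of_nonneg fun i _ => hb _ _,
      Fin.sum_univ_eq_sum_range (fun k => momentFunctional m (bernsteinPolynomial ℝ N k)), hsum,
      ENNReal.ofReal_one]
  have hint (N j : ℕ) : ∫ x, (x : ℝ) ^ j ∂(μ N) = momentFunctional m (bernsteinOfPow N j) := by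
    rw [integral_finsetSum_measure]
    · simp only [integral_smul_measure, integral_dirac, ENNReal.toReal_ofReal (hb _ _),
        bernsteinOfPow, map_sum, map_smul, smul_eq_mul]
      rw [← Fin.sum_univ_eq_sum_range
        (fun k => ((k : ℝ) / N) ^ j * momentFunctional m (bernsteinPolynomial ℝ N k))]
      refine Finset.sum_congr rfl fun k _ => ?_
      rw [mul_comm]
      rfl
    · intro i _
      refine Integrable.smul_measure ?_ ENNReal.ofReal_ne_top
      exact integrable_dirac (by simp)
  obtain ⟨ρ, -, φ, hφ, hlim⟩ := (isCompact_univ (X := ProbabilityMeasure unitInterval)).isSeqCompact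
    (x := fun N => (⟨μ N, hμ N⟩ : ProbabilityMeasure unitInterval)) (fun _ => Set.mem_univ _)
  refine ⟨ρ, fun j => ?_⟩
  have h1 := ProbabilityMeasure.tendsto_iff_forall_integral_tendsto.mp hlim
    (BoundedContinuousFunction.mkOfCompact ⟨fun x : unitInterval => (x : ℝ) ^ j, by fun_prop⟩)
  have h2 := (tendsto_apply_bernsteinOfPow j (momentFunctional m)).comp hφ.tendsto_atTop
  rw [momentFunctional_X_pow] at h2
  refine tendsto_nhds_unique h1 (h2.congr fun N => ?_)
  exact (hint _ _).symm

/-- Probability measures on the unit interval are determined by their moments. -/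
theorem measure_unitInterval_ext_of_integral_pow {μ ρ : Measure unitInterval}
    [IsProbabilityMeasure μ] [IsProbabilityMeasure ρ]
    (h : ∀ j : ℕ, ∫ x, (x : ℝ) ^ j ∂μ = ∫ x, (x : ℝ) ^ j ∂ρ) : μ = ρ := by
  have hint (f : C(unitInterval, ℝ)) (κ : Measure unitInterval) [IsProbabilityMeasure κ] :
      Integrable f κ := f.continuous.integrable_of_hasCompactSupport
        (HasCompactSupport.of_compactSpace f)
  have hpoly (p : Polynomial ℝ) : ∫ x : unitInterval, p.eval (x : ℝ) ∂μ
      = ∫ x : unitInterval, p.eval (x : ℝ) ∂ρ := by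
    simp only [Polynomial.eval_eq_sum_range]
    rw [integral_finsetSum, integral_finsetSum]
    · simp only [integral_const_mul, h]
    · exact fun i _ => hint ⟨fun x => p.coeff i * (x : ℝ) ^ i, by fun_prop⟩ ρ
    · exact fun i _ => hint ⟨fun x => p.coeff i * (x : ℝ) ^ i, by fun_prop⟩ μ
  have hber (f : C(unitInterval, ℝ)) (N : ℕ) :
      ∫ x, bernsteinApproximation N f x ∂μ = ∫ x, bernsteinApproximation N f x ∂ρ := by
    have key (κ : Measure unitInterval) [IsProbabilityMeasure κ] :
        ∫ x, bernsteinApproximation N f x ∂κ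
          = ∑ k : Fin (N + 1), (∫ x : unitInterval,
              (bernsteinPolynomial ℝ N k).eval (x : ℝ) ∂κ) * f (bernstein.z k) := by
      simp only [bernsteinApproximation.apply, smul_eq_mul]
      rw [integral_finsetSum]
      · simp only [integral_mul_const]
        rfl
      · exact fun k _ => (hint (bernstein N k) κ).mul_const _
    rw [key μ, key ρ]
    simp only [hpoly]
  have hcont (κ : Measure unitInterval) [IsProbabilityMeasure κ] (f : C(unitInterval, ℝ)) :
      Filter.Tendsto (fun N => ∫ x, bernsteinApproximation N f x ∂κ) Filter.atTop
        (nhds (∫ x, f x ∂κ)) := by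
    rw [tendsto_iff_dist_tendsto_zero]
    refine squeeze_zero (fun _ => dist_nonneg) (fun N => ?_)
      (tendsto_iff_dist_tendsto_zero.mp (bernsteinApproximation_uniform f))
    rw [dist_eq_norm, ← integral_sub (hint _ κ) (hint _ κ), dist_eq_norm]
    refine (norm_integral_le_of_norm_le_const (Filter.Eventually.of_forall fun x =>
      ContinuousMap.norm_coe_le_norm (bernsteinApproximation N f - f) x)).trans ?_
    simp
  refine ext_of_forall_integral_eq_of_IsFiniteMeasure fun f => ?_
  exact tendsto_nhds_unique (hcont μ f.toContinuousMap)
    ((hcont ρ f.toContinuousMap).congr fun N => (hber _ N).symm)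

/-- The truncated gamma integral `∫_z^∞ (x - z)^n x^(p-1) e^(-x) dx`. -/
noncomputable def gammaTail (n : ℕ) (p z : ℝ) : ℝ :=
  ∫ x in Set.Ioi z, (x - z) ^ n * (x ^ (p - 1) * Real.exp (-x))

/-- Minus the derivative of `gammaTail n p` at a positive point. -/
noncomputable def gammaTailSlope (n : ℕ) (p z : ℝ) : ℝ :=
  if n = 0 then z ^ (p - 1) * Real.exp (-z) else n * gammaTail (n - 1) p z

lemma integrableOn_Ioi_rpow_mul_exp_neg (p : ℝ) {z : ℝ} (hz : 0 < z) :
    IntegrableOn (fun x : ℝ => x ^ p * Real.exp (-x)) (Set.Ioi z) := by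
  refine integrable_of_isBigO_exp_neg (b := 1 / 2) (by norm_num) ?_ ?_
  · intro x hx
    have hx0 : x ≠ 0 := (hz.trans_le hx).ne'
    exact ((Real.continuousAt_rpow_const x p (Or.inl hx0)).mul
      (by fun_prop)).continuousWithinAt
  · refine ((Real.Gamma_integrand_isLittleO p).isBigO).congr_left fun x => mul_comm _ _

lemma integrableOn_gammaTail (n : ℕ) (p : ℝ) {z : ℝ} (hz : 0 < z) :
    IntegrableOn (fun x : ℝ => (x - z) ^ n * (x ^ (p - 1) * Real.exp (-x))) (Set.Ioi z) := by
  induction n generalizing p with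
  | zero => simpa using integrableOn_Ioi_rpow_mul_exp_neg (p - 1) hz
  | succ n ih =>
    refine ((ih (p + 1)).sub ((ih p).const_mul z)).congr_fun (fun x hx => ?_) measurableSet_Ioi
    have hx0 : x ≠ 0 := (hz.trans hx).ne'
    have : x ^ (p + 1 - 1) = x ^ (p - 1) * x := by
      rw [← Real.rpow_add_one hx0]; ring_nf
    simp only [Pi.sub_apply, this]
    ring

lemma gammaTail_succ (n : ℕ) (p : ℝ) {z : ℝ} (hz : 0 < z) :
    gammaTail (n + 1) p z = gammaTail n (p + 1) z - z * gammaTail n p z := by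
  unfold gammaTail
  rw [← integral_const_mul, ← integral_sub (integrableOn_gammaTail n (p + 1) hz)
    ((integrableOn_gammaTail n p hz).const_mul z)]
  refine setIntegral_congr_fun measurableSet_Ioi fun x hx => ?_
  have hx0 : x ≠ 0 := (hz.trans hx).ne'
  have : x ^ (p + 1 - 1) = x ^ (p - 1) * x := by
    rw [← Real.rpow_add_one hx0]; ring_nf
  simp only [this]
  ring

lemma gammaTailSlope_succ (n : ℕ) (p : ℝ) {z : ℝ} (hz : 0 < z) :
    gammaTailSlope (n + 1) p z
      = gammaTailSlope n (p + 1) z - z * gammaTailSlope n p z + gammaTail n p z := by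
  cases n with
  | zero =>
    have : z ^ (p + 1 - 1) = z ^ (p - 1) * z := by
      rw [← Real.rpow_add_one hz.ne']; ring_nf
    simp only [gammaTailSlope, this]
    simp
    ring
  | succ n =>
    simp only [gammaTailSlope, Nat.succ_ne_zero, if_false, Nat.add_sub_cancel,
      gammaTail_succ n p hz]
    push_cast
    ring

lemma hasDerivAt_gammaTail (n : ℕ) (p : ℝ) {z : ℝ} (hz : 0 < z) :
    HasDerivAt (gammaTail n p) (-gammaTailSlope n p z) z := by
  induction n generalizing p with
  | zero =>
    have hint := integrableOn_Ioi_rpow_mul_exp_neg (p - 1) (half_pos hz)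
    have hev : gammaTail 0 p =ᶠ[nhds z] fun u =>
        (∫ x in Set.Ioi (z / 2), x ^ (p - 1) * Real.exp (-x))
          - ∫ x in (z / 2)..u, x ^ (p - 1) * Real.exp (-x) := by
      filter_upwards [lt_mem_nhds (half_lt_self hz)] with u hu
      rw [← intervalIntegral.integral_Ioi_sub_Ioi hint hu.le]
      simp [gammaTail]
    refine HasDerivAt.congr_of_eventuallyEq ?_ hev
    simp only [gammaTailSlope, if_true]
    refine HasDerivAt.const_sub _ ?_
    have hcont (x : ℝ) (hx : 0 < x) :
        ContinuousAt (fun x : ℝ => x ^ (p - 1) * Real.exp (-x)) x :=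
      (Real.continuousAt_rpow_const x _ (Or.inl hx.ne')).mul (by fun_prop)
    refine intervalIntegral.integral_hasDerivAt_right ?_ ?_ (hcont z hz)
    · rw [intervalIntegrable_iff_integrableOn_Ioc_of_le (half_lt_self hz).le]
      exact hint.mono_set Set.Ioc_subset_Ioi_self
    · exact ContinuousAt.stronglyMeasurableAtFilter isOpen_Ioi
        (fun x hx => hcont x hx) z (show z ∈ Set.Ioi 0 from hz)
  | succ n ih =>
    have hev : gammaTail (n + 1) p =ᶠ[nhds z]
        fun u => gammaTail n (p + 1) u - u * gammaTail n p u := by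
      filter_upwards [lt_mem_nhds hz] with u hu using gammaTail_succ n p hu
    refine HasDerivAt.congr_of_eventuallyEq ?_ hev
    refine ((ih (p + 1)).fun_sub ((hasDerivAt_id' z).fun_mul (ih p))).congr_deriv ?_
    rw [gammaTailSlope_succ n p hz]
    ring

lemma gammaTailSlope_add (n : ℕ) (p : ℝ) {z : ℝ} (hz : 0 < z) :
    gammaTailSlope n (p + 1) z + p * gammaTail n p z = gammaTail n (p + 1) z := by
  induction n generalizing p with
  | zero =>
    have hderiv (x : ℝ) (hx : 0 < x) : HasDerivAt (fun x : ℝ => x ^ p * Real.exp (-x))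
        (p * (x ^ (p - 1) * Real.exp (-x)) - x ^ p * Real.exp (-x)) x := by
      refine ((Real.hasDerivAt_rpow_const (p := p) (Or.inl hx.ne')).fun_mul
        ((hasDerivAt_neg x).exp)).congr_deriv ?_
      ring
    have h1 := integrableOn_Ioi_rpow_mul_exp_neg (p - 1) hz
    have h2 := integrableOn_Ioi_rpow_mul_exp_neg p hz
    have hlim : Filter.Tendsto (fun x : ℝ => x ^ p * Real.exp (-x)) Filter.atTop (nhds 0) := by
      simpa using tendsto_rpow_mul_exp_neg_mul_atTop_nhds_zero p 1 one_pos
    have h3 := integral_Ioi_of_hasDerivAt_of_tendsto (hderiv z hz).continuousAt.continuousWithinAt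
      (fun x hx => hderiv x (hz.trans hx)) ((h1.const_mul p).sub h2) hlim
    rw [integral_sub (h1.const_mul p) h2, integral_const_mul] at h3
    simp only [gammaTailSlope, gammaTail, if_true, pow_zero, one_mul, add_sub_cancel_right]
    linarith
  | succ n ih =>
    rw [gammaTailSlope_succ n _ hz, gammaTail_succ n _ hz, gammaTail_succ n _ hz]
    linear_combination ih (p + 1) - z * ih p

lemma mul_gammaTailSlope (n : ℕ) (p : ℝ) {z : ℝ} (hz : 0 < z) :
    z * gammaTailSlope n p z = (-n - p + z) * gammaTail n p z + gammaTail (n + 1) p z := by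
  have h1 := gammaTailSlope_succ n p hz
  have h2 := gammaTailSlope_add n p hz
  have h3 := gammaTail_succ n p hz
  have h4 : gammaTailSlope (n + 1) p z = (n + 1) * gammaTail n p z := by
    simp [gammaTailSlope]
  linarith

lemma gammaTail_pos (n : ℕ) (p : ℝ) {z : ℝ} (hz : 0 < z) : 0 < gammaTail n p z := by
  have hpos : ∀ x ∈ Set.Ioi z, 0 < (x - z) ^ n * (x ^ (p - 1) * Real.exp (-x)) := by
    intro x hx
    have := Real.rpow_pos_of_pos (hz.trans hx) (p - 1)
    have := pow_pos (sub_pos.mpr (show z < x from hx)) n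
    positivity
  refine (setIntegral_pos_iff_support_of_nonneg_ae ?_ (integrableOn_gammaTail n p hz)).mpr ?_
  · exact (ae_restrict_iff' measurableSet_Ioi).mpr
      (Filter.Eventually.of_forall fun x hx => (hpos x hx).le)
  · rw [Set.inter_eq_right.mpr fun x hx => Function.mem_support.mpr (hpos x hx).ne']
    simp

lemma second_deriv_nonneg_of_isLocalMin {w w' : ℝ → ℝ} {w'' z : ℝ} (hmin : IsLocalMin w z)
    (hw : ∀ᶠ u in nhds z, HasDerivAt w (w' u) u) (hw' : HasDerivAt w' w'' z) : 0 ≤ w'' := by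
  by_contra! hneg
  have hd : deriv w =ᶠ[nhds z] w' := hw.mono fun u hu => hu.deriv
  have hdd : deriv (deriv w) z = w'' := by rw [hd.deriv_eq, hw'.deriv]
  have hmax : IsLocalMax w z := isLocalMax_of_deriv_deriv_neg (hdd ▸ hneg) hmin.deriv_eq_zero
    hw.self_of_nhds.continuousAt
  have hconst : w =ᶠ[nhds z] fun _ => w z := by
    filter_upwards [hmin, hmax] with u h1 h2 using le_antisymm h2 h1
  have : deriv w =ᶠ[nhds z] fun _ => 0 := by simpa using hconst.deriv
  rw [this.deriv_eq, deriv_const] at hdd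
  exact hneg.ne hdd.symm

/-- A minimum principle on a half-line for the operator `z ∂² + β(z) ∂ - κ`, `κ ≥ 0`. -/
lemma pos_of_second_order_neg {w w' w'' β : ℝ → ℝ} {y κ l : ℝ} (hy : 0 < y) (hκ : 0 ≤ κ)
    (hw : ∀ z, 0 < z → HasDerivAt w (w' z) z) (hw' : ∀ z, 0 < z → HasDerivAt w' (w'' z) z)
    (hwy : w y = 0) (hl : 0 ≤ l) (hlim : Filter.Tendsto w Filter.atTop (nhds l))
    (hL : ∀ z, y < z → z * w'' z + β z * w' z - κ * w z < 0) :
    ∀ z, y < z → 0 < w z := by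
  have hmin : ∀ z, y < z → w z ≤ 0 → ¬ IsLocalMin w z := by
    intro z hz hwz hm
    have hz0 := hy.trans hz
    have h1 : w' z = 0 := hm.hasDerivAt_eq_zero (hw z hz0)
    have h2 := second_deriv_nonneg_of_isLocalMin hm
      ((lt_mem_nhds hz0).mono fun u hu => hw u hu) (hw' z hz0)
    have h3 := hL z hz
    rw [h1] at h3
    nlinarith [mul_nonneg hz0.le h2, mul_nonneg hκ (neg_nonneg.mpr hwz)]
  have hnonneg : ∀ z, y < z → 0 ≤ w z := by
    by_contra! hneg
    obtain ⟨z₁, hz₁, hwz₁⟩ := hneg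
    obtain ⟨R, hR, hwR⟩ := ((Filter.eventually_gt_atTop z₁).and
      (hlim.eventually_const_lt (hwz₁.trans_le hl))).exists
    obtain ⟨z₂, hz₂, hm⟩ := isCompact_Icc.exists_isMinOn (s := Set.Icc y R)
      ⟨z₁, hz₁.le, hR.le⟩
      (fun u hu => (hw u (hy.trans_le hu.1)).continuousAt.continuousWithinAt)
    have hle : w z₂ ≤ w z₁ := hm ⟨hz₁.le, hR.le⟩
    have hy₂ : y < z₂ := lt_of_le_of_ne hz₂.1 (by rintro rfl; linarith)
    have hR₂ : z₂ < R := lt_of_le_of_ne hz₂.2 (by rintro rfl; linarith)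
    exact hmin z₂ hy₂ (hle.trans hwz₁.le) (hm.isLocalMin (Icc_mem_nhds hy₂ hR₂))
  intro z hz
  refine lt_of_le_of_ne (hnonneg z hz) fun h => hmin z hz h.symm.le ?_
  filter_upwards [lt_mem_nhds hz] with u hu
  rw [← h]
  exact hnonneg u hu

lemma hasDerivAt_momentFunctional {F F' : ℕ → ℝ → ℝ} {z : ℝ}
    (hF : ∀ n, HasDerivAt (F n) (F' n z) z) (p : Polynomial ℝ) :
    HasDerivAt (fun u => momentFunctional (fun n => F n u) p)
      (momentFunctional (fun n => F' n z) p) z := by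
  simp only [momentFunctional_apply]
  exact HasDerivAt.fun_sum fun n _ => (hF n).const_mul _

lemma tendsto_momentFunctional {F : ℕ → ℝ → ℝ} {m : ℕ → ℝ} {l : Filter ℝ}
    (hF : ∀ n, Filter.Tendsto (F n) l (nhds (m n))) (p : Polynomial ℝ) :
    Filter.Tendsto (fun u => momentFunctional (fun n => F n u) p) l
      (nhds (momentFunctional m p)) := by
  simp only [momentFunctional_apply]
  exact tendsto_finsetSum _ fun n _ => (hF n).const_mul _

lemma momentFunctional_pow (x : ℝ) (p : Polynomial ℝ) :
    momentFunctional (fun n => x ^ n) p = p.eval x := by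
  rw [momentFunctional_apply, Polynomial.eval_eq_sum, Polynomial.sum_def]

lemma momentFunctional_X_mul_derivative (m : ℕ → ℝ) (p : Polynomial ℝ) :
    momentFunctional m (Polynomial.X * Polynomial.derivative p)
      = momentFunctional (fun n => n * m n) p := by
  induction p using Polynomial.induction_on' with
  | add p q hp hq => simp only [mul_add, map_add, hp, hq]
  | monomial n a =>
    rw [← Polynomial.C_mul_X_pow_eq_monomial, ← Polynomial.smul_eq_C_mul,
      Polynomial.derivative_smul, mul_smul_comm, X_mul_derivative_X_pow, map_smul, map_smul,
      momentFunctional_X_pow, ← Polynomial.C_eq_natCast, ← Polynomial.smul_eq_C_mul, map_smul,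
      momentFunctional_X_pow, smul_eq_mul, smul_eq_mul, smul_eq_mul]

/-- If `F n` solves `z F'' + β F' = n F` on a half-line with value `1` at the endpoint and decay
at infinity, then `n ↦ F n z` is completely monotone. -/
theorem momentFunctional_pos_of_ode {F F' F'' : ℕ → ℝ → ℝ} {β : ℝ → ℝ} {y : ℝ} (hy : 0 < y)
    (hF : ∀ n z, 0 < z → HasDerivAt (F n) (F' n z) z)
    (hF' : ∀ n z, 0 < z → HasDerivAt (F' n) (F'' n z) z)
    (hode : ∀ n z, 0 < z → z * F'' n z + β z * F' n z = n * F n z)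
    (hFy : ∀ n, F n y = 1) (hpos : ∀ n z, y < z → 0 < F n z)
    (hlim : ∀ n, Filter.Tendsto (F n) Filter.atTop (nhds (0 ^ n))) (k n : ℕ) {z : ℝ}
    (hz : y < z) :
    0 < momentFunctional (fun i => F i z) (Polynomial.X ^ n * (1 - Polynomial.X) ^ k) := by
  induction k generalizing n z with
  | zero => simpa [momentFunctional_X_pow] using hpos n z hz
  | succ k ih =>
    set p : Polynomial ℝ := Polynomial.X ^ n * (1 - Polynomial.X) ^ (k + 1) with hp
    have hXp : Polynomial.X * Polynomial.derivative p
        = (n : ℝ) • p - (k + 1 : ℝ) • (Polynomial.X ^ (n + 1) * (1 - Polynomial.X) ^ k) := by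
      have h1 := X_mul_derivative_X_pow n
      simp only [hp, Polynomial.derivative_mul, Polynomial.derivative_pow_succ,
        Polynomial.derivative_sub, Polynomial.derivative_one, Polynomial.derivative_X,
        Polynomial.smul_eq_C_mul, Polynomial.C_add, Polynomial.C_1, Polynomial.C_eq_natCast]
      linear_combination (1 - Polynomial.X) ^ (k + 1) * h1
    refine pos_of_second_order_neg (κ := n) (β := β) (l := p.eval 0) hy (Nat.cast_nonneg n)
      (fun z hz => hasDerivAt_momentFunctional (fun i => hF i z hz) p)
      (fun z hz => hasDerivAt_momentFunctional (fun i => hF' i z hz) p) ?_ ?_ ?_ ?_ z hz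
    · have h := momentFunctional_pow 1 p
      simp only [one_pow] at h
      simp only [hFy, h]
      simp [hp]
    · simp [hp]
    · rw [← momentFunctional_pow]
      exact tendsto_momentFunctional hlim p
    · intro z hz
      have h1 : z * momentFunctional (fun i => F'' i z) p
          + β z * momentFunctional (fun i => F' i z) p
          = momentFunctional (fun i => i * F i z) p := by
        simp only [momentFunctional_apply, Finset.mul_sum, ← Finset.sum_add_distrib,
          ← hode _ z (hy.trans hz)]
        exact Finset.sum_congr rfl fun i _ => by ring
      rw [h1, ← momentFunctional_X_mul_derivative, hXp, map_sub, map_smul, map_smul, smul_eq_mul,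
        smul_eq_mul]
      have := ih (n + 1) hz
      have hk : (0 : ℝ) < k + 1 := by positivity
      nlinarith [mul_pos hk this]

lemma integral_max_one_sub_div_pow_gammaMeasure {ν : ℝ} (hν : 0 < ν) (n : ℕ) {z : ℝ}
    (hz : 0 < z) :
    ∫ x, max (1 - z / x) 0 ^ (n + 1) ∂(gammaMeasure ν 1)
      = (Real.Gamma ν)⁻¹ * gammaTail (n + 1) (ν - (n + 1)) z := by
  have hmeas : Measurable (gammaPDF ν 1) := (measurable_gammaPDFReal ν 1).ennreal_ofReal
  rw [gammaMeasure, integral_withDensity_eq_integral_toReal_smul hmeas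
    (Filter.Eventually.of_forall fun x => ENNReal.ofReal_lt_top), gammaTail, ← integral_const_mul,
    ← integral_indicator measurableSet_Ioi]
  refine integral_congr_ae ?_
  filter_upwards [compl_mem_ae_iff.mpr (measure_singleton (μ := volume) (0 : ℝ))] with x hx
  have hx0 : x ≠ 0 := hx
  rw [gammaPDF, ENNReal.toReal_ofReal (gammaPDFReal_nonneg hν one_pos x), smul_eq_mul]
  by_cases hxz : z < x
  · have hxpos := hz.trans hxz
    have h1 : x ^ (ν - 1) = x ^ (n + 1) * x ^ (ν - (n + 1) - 1) := by
      rw [← Real.rpow_natCast, ← Real.rpow_add hxpos]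
      push_cast
      ring_nf
    have h2 : max (1 - z / x) 0 = (x - z) / x := by
      rw [max_eq_left (sub_nonneg.mpr ((div_le_one hxpos).mpr hxz.le))]
      field_simp
    rw [Set.indicator_of_mem (show x ∈ Set.Ioi z from hxz), gammaPDFReal, if_pos hxpos.le, h1, h2,
      Real.one_rpow, one_mul, div_pow]
    field_simp
  · rw [Set.indicator_of_notMem (show x ∉ Set.Ioi z from hxz)]
    rcases lt_or_gt_of_ne hx0 with hneg | hxpos
    · rw [gammaPDFReal, if_neg hneg.not_ge, zero_mul]
    · rw [max_eq_right (sub_nonpos.mpr ((one_le_div hxpos).mpr (not_lt.mp hxz)))]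
      simp

lemma ae_pos_gammaMeasure (ν : ℝ) : ∀ᵐ x ∂(gammaMeasure ν 1), 0 < x := by
  have hmeas : Measurable (gammaPDF ν 1) := (measurable_gammaPDFReal ν 1).ennreal_ofReal
  rw [gammaMeasure, ae_withDensity_iff hmeas]
  filter_upwards [compl_mem_ae_iff.mpr (measure_singleton (μ := volume) (0 : ℝ))] with x hx hpdf
  have hx0 : x ≠ 0 := hx
  by_contra hneg
  exact hpdf (gammaPDF_of_neg (lt_of_le_of_ne (not_lt.mp hneg) hx0))

lemma max_one_sub_div_mem_Icc {z x : ℝ} (hz : 0 < z) (hx : 0 < x) :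
    max (1 - z / x) 0 ∈ Set.Icc (0 : ℝ) 1 :=
  ⟨le_max_right _ _, max_le (by have := div_pos hz hx; linarith) zero_le_one⟩

lemma tendsto_gammaTail_atTop {ν : ℝ} (hν : 0 < ν) (n : ℕ) :
    Filter.Tendsto (gammaTail (n + 1) (ν - (n + 1))) Filter.atTop (nhds 0) := by
  have := isProbabilityMeasure_gammaMeasure hν one_pos
  have h : Filter.Tendsto (fun z => ∫ x, max (1 - z / x) 0 ^ (n + 1) ∂(gammaMeasure ν 1))
      Filter.atTop (nhds (∫ _, (0 : ℝ) ∂(gammaMeasure ν 1))) := by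
    refine tendsto_integral_filter_of_dominated_convergence (fun _ => 1) ?_ ?_
      (integrable_const _) ?_
    · exact Filter.Eventually.of_forall fun z => by fun_prop
    · filter_upwards [Filter.eventually_gt_atTop 0] with z hz
      filter_upwards [ae_pos_gammaMeasure ν] with x hx
      have hm := max_one_sub_div_mem_Icc hz hx
      rw [Real.norm_of_nonneg (pow_nonneg hm.1 _)]
      exact pow_le_one₀ hm.1 hm.2
    · filter_upwards [ae_pos_gammaMeasure ν] with x hx
      refine tendsto_const_nhds.congr' ?_
      filter_upwards [Filter.eventually_ge_atTop x] with z hz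
      rw [max_eq_right (sub_nonpos.mpr ((one_le_div hx).mpr hz))]
      simp
  rw [integral_zero] at h
  have h2 := h.const_mul (Real.Gamma ν)
  rw [mul_zero] at h2
  refine h2.congr' ?_
  filter_upwards [Filter.eventually_gt_atTop 0] with z hz
  rw [integral_max_one_sub_div_pow_gammaMeasure hν n hz,
    mul_inv_cancel_left₀ (Real.Gamma_pos_of_pos hν).ne']

/-- For `0 < y < z` the moments of `(1 - z / G)₊`, `G` gamma distributed, are those of
`(1 - y / G)₊` multiplied by the moments of a probability measure on the unit interval. -/
theorem exists_moment_factor {ν y z : ℝ} (hν : 0 < ν) (hy : 0 < y) (hyz : y < z) :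
    ∃ ρ : ProbabilityMeasure unitInterval, ∀ j : ℕ,
      ∫ x, max (1 - z / x) 0 ^ j ∂(gammaMeasure ν 1)
        = (∫ s, (s : ℝ) ^ j ∂(ρ : Measure unitInterval))
          * ∫ x, max (1 - y / x) 0 ^ j ∂(gammaMeasure ν 1) := by
  have := isProbabilityMeasure_gammaMeasure hν one_pos
  let c (n : ℕ) : ℝ := gammaTail (n + 1) (ν - (n + 1)) y
  have hc (n : ℕ) : 0 < c n := gammaTail_pos _ _ hy
  let F (n : ℕ) (u : ℝ) : ℝ := n.casesOn 1 fun n => gammaTail (n + 1) (ν - (n + 1)) u / c n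
  let F' (n : ℕ) (u : ℝ) : ℝ :=
    n.casesOn 0 fun n => -((n + 1) * gammaTail n (ν - (n + 1)) u) / c n
  let F'' (n : ℕ) (u : ℝ) : ℝ :=
    n.casesOn 0 fun n => ((n + 1) * gammaTailSlope n (ν - (n + 1)) u) / c n
  have hcm := momentFunctional_pos_of_ode (F := F) (F' := F') (F'' := F'')
    (β := fun u => 1 - ν + u) hy ?_ ?_ ?_ ?_ ?_ ?_
  · obtain ⟨ρ, hρ⟩ := exists_probabilityMeasure_integral_pow_eq (fun n => F n z) rfl
      fun n k => (hcm k n hyz).le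
    refine ⟨ρ, fun j => ?_⟩
    rw [hρ]
    cases j with
    | zero => simp [F]
    | succ n =>
      rw [integral_max_one_sub_div_pow_gammaMeasure hν n hy,
        integral_max_one_sub_div_pow_gammaMeasure hν n (hy.trans hyz)]
      have := (hc n).ne'
      simp only [F, c] at this ⊢
      field_simp
  · rintro (_ | n) u hu
    · exact hasDerivAt_const u 1
    · refine ((hasDerivAt_gammaTail (n + 1) (ν - (n + 1)) hu).div_const (c n)).congr_deriv ?_
      simp [F', gammaTailSlope]
  · rintro (_ | n) u hu
    · exact hasDerivAt_const u 0
    · refine ((((hasDerivAt_gammaTail n (ν - (n + 1)) hu).const_mul (n + 1 : ℝ)).fun_neg).div_const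
        (c n)).congr_deriv ?_
      simp [F'']
  · rintro (_ | n) u hu
    · simp [F', F'']
    · have h := mul_gammaTailSlope n (ν - (n + 1)) hu
      have := (hc n).ne'
      simp only [F, F', F'']
      push_cast
      field_simp
      linear_combination h
  · rintro (_ | n)
    · rfl
    · exact div_self (hc n).ne'
  · rintro (_ | n) u hu
    · exact one_pos
    · exact div_pos (gammaTail_pos _ _ (hy.trans hu)) (hc n)
  · rintro (_ | n)
    · simp [F]
    · simpa [F] using (tendsto_gammaTail_atTop hν n).div_const (c n)

lemma isProbabilityMeasure_invGammaLaw {ν : ℝ} (hν : 0 < ν) :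
    IsProbabilityMeasure (invGammaLaw ν) := by
  have := isProbabilityMeasure_gammaMeasure hν one_pos
  exact Measure.isProbabilityMeasure_map (by fun_prop)

lemma ae_pos_invGammaLaw (ν : ℝ) : ∀ᵐ x ∂(invGammaLaw ν), 0 < x := by
  rw [invGammaLaw, ae_map_iff (by fun_prop) measurableSet_Ioi]
  filter_upwards [ae_pos_gammaMeasure ν] with x hx
  positivity

lemma integral_max_one_sub_div_pow_invGammaLaw (ν b : ℝ) (j : ℕ) :
    ∫ x, max (1 - x / b) 0 ^ j ∂(invGammaLaw ν)
      = ∫ x, max (1 - 1 / (2 * b) / x) 0 ^ j ∂(gammaMeasure ν 1) := by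
  rw [invGammaLaw, integral_map (by fun_prop) (by fun_prop)]
  refine integral_congr_ae (Filter.Eventually.of_forall fun x => ?_)
  have : 1 / (2 * x) / b = 1 / (2 * b) / x := by
    rw [div_div, div_div]; ring_nf
  simp only [this]

theorem stmt16 (ν b c : ℝ) (hν : 0 < ν) (hb : 0 < b) (hbc : b < c) :
    ∃ (Ω : Type) (_ : MeasurableSpace Ω) (P : Measure Ω) (Z S : Ω → ℝ),
      IsProbabilityMeasure P ∧ Measurable Z ∧ Measurable S ∧
      Measure.map Z P = invGammaLaw ν ∧
      (∀ ω, S ω ∈ Set.Icc (0:ℝ) 1) ∧ IndepFun S Z P ∧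
      Measure.map (fun ω => max (1 - Z ω / b) 0) P
        = Measure.map (fun ω => S ω * max (1 - Z ω / c) 0) P := by
  have hc : 0 < c := hb.trans hbc
  have := isProbabilityMeasure_invGammaLaw hν
  obtain ⟨ρ, hρ⟩ := exists_moment_factor (y := 1 / (2 * c)) (z := 1 / (2 * b)) hν (by positivity)
    (one_div_lt_one_div_of_lt (by positivity) (by linarith))
  let P : Measure (ℝ × unitInterval) := (invGammaLaw ν).prod (ρ : Measure unitInterval)
  let S : ℝ × unitInterval → ℝ := fun ω => (ω.2 : ℝ)
  have hS : Measurable S := measurable_subtype_coe.comp measurable_snd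
  have hfst : Measure.map Prod.fst P = invGammaLaw ν := by simp [P]
  refine ⟨ℝ × unitInterval, inferInstance, P, Prod.fst, S, inferInstance, measurable_fst, hS,
    hfst, fun ω => ω.2.2, ?_, ?_⟩
  · exact (indepFun_prod (μ := invGammaLaw ν) (ν := (ρ : Measure unitInterval)) measurable_id
      measurable_subtype_coe).symm
  let U (d : ℝ) (ω : ℝ × unitInterval) : unitInterval :=
    Set.projIcc 0 1 zero_le_one (max (1 - ω.1 / d) 0)
  have hU (d : ℝ) : Measurable (U d) := continuous_projIcc.measurable.comp (by fun_prop)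
  have hUeq (d : ℝ) (hd : 0 < d) : ∀ᵐ ω ∂P, (U d ω : ℝ) = max (1 - ω.1 / d) 0 := by
    have hpos : ∀ᵐ ω ∂P, 0 < ω.1 :=
      ae_of_ae_map measurable_fst.aemeasurable (hfst ▸ ae_pos_invGammaLaw ν)
    filter_upwards [hpos] with ω hω
    have hmem : max (1 - ω.1 / d) 0 ∈ Set.Icc (0 : ℝ) 1 :=
      ⟨le_max_right _ _, max_le (by have := div_pos hω hd; linarith) zero_le_one⟩
    simp only [U, Set.projIcc_of_mem zero_le_one hmem]
  have hUS : Measurable fun ω => ω.2 * U c ω := measurable_snd.mul (hU c)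
  have key : Measure.map (U b) P = Measure.map (fun ω => ω.2 * U c ω) P := by
    have := Measure.isProbabilityMeasure_map (μ := P) (hU b).aemeasurable
    have := Measure.isProbabilityMeasure_map (μ := P) hUS.aemeasurable
    refine measure_unitInterval_ext_of_integral_pow fun j => ?_
    rw [integral_map (hU b).aemeasurable (by fun_prop), integral_map hUS.aemeasurable (by fun_prop)]
    have h1 : ∫ ω, (U b ω : ℝ) ^ j ∂P = ∫ x, max (1 - x / b) 0 ^ j ∂(invGammaLaw ν) := by
      rw [← hfst, integral_map measurable_fst.aemeasurable (by fun_prop)]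
      refine integral_congr_ae ?_
      filter_upwards [hUeq b hb] with ω hω
      rw [hω]
    have h2 : ∫ ω, ((ω.2 * U c ω : unitInterval) : ℝ) ^ j ∂P
        = (∫ x, max (1 - x / c) 0 ^ j ∂(invGammaLaw ν))
          * ∫ s, (s : ℝ) ^ j ∂(ρ : Measure unitInterval) := by
      rw [← integral_prod_mul]
      refine integral_congr_ae ?_
      filter_upwards [hUeq c hc] with ω hω
      rw [Set.Icc.coe_mul, hω, mul_pow, mul_comm]
    rw [h1, h2, integral_max_one_sub_div_pow_invGammaLaw, integral_max_one_sub_div_pow_invGammaLaw,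
      hρ, mul_comm]
  calc Measure.map (fun ω => max (1 - ω.1 / b) 0) P
      = Measure.map (fun ω => (U b ω : ℝ)) P :=
        Measure.map_congr ((hUeq b hb).mono fun ω hω => hω.symm)
    _ = Measure.map (fun x : unitInterval => (x : ℝ)) (Measure.map (U b) P) :=
        (Measure.map_map measurable_subtype_coe (hU b)).symm
    _ = Measure.map (fun ω => ((ω.2 * U c ω : unitInterval) : ℝ)) P := by
        rw [key, Measure.map_map measurable_subtype_coe hUS]
        rfl
    _ = Measure.map (fun ω => S ω * max (1 - ω.1 / c) 0) P := by
        refine Measure.map_congr ((hUeq c hc).mono fun ω hω => ?_)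
        simp only [Set.Icc.coe_mul, hω, S]
end

section
/- Fix ν > 0 and b > c > 0. Let ζ be the inverse-gamma law with parameter ν, and for α > 0 let μ_α be the probability measure on (α,∞) defined by μ_α(dz) = (z−α)^{ν−1} 1_{z>α} ζ(dz) / N_α, where N_α = ∫_{(α,∞)} (z−α)^{ν−1} ζ(dz). Then there exist a probability space carrying random variables Z_b with law μ_b, Z_c with law μ_c, and Y with values in (0,1], with Y independent of Z_c, such that Z_b/b − 1 and Y·(Z_c/c − 1) have the same distribution. -/
open MeasureTheory ProbabilityTheory Real Set

/-- The tilted inverse-gamma law `μ_α(dz) = (z−α)^{ν−1} 1_{z>α} ζ(dz) / N_α`, where `ζ`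
is the inverse-gamma law with parameter `ν` and `N_α` is the normalizing constant. -/
noncomputable def tiltedInvGamma (ν α : ℝ) : Measure ℝ :=
  ((invGammaLaw ν).withDensity
      (fun z => ENNReal.ofReal (if α < z then (z - α) ^ (ν - 1) else 0)) Set.univ)⁻¹ •
    (invGammaLaw ν).withDensity
      (fun z => ENNReal.ofReal (if α < z then (z - α) ^ (ν - 1) else 0))


/-- `φ` agrees on `(0, c)` with the moment function `a ↦ ∫ yᵃ dρ` of a probability measure `ρ`
on the unit interval. -/
def IsMomentFn (c : ℝ) (φ : ℝ → ℝ) : Prop :=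
  ∃ ρ : ProbabilityMeasure unitInterval,
    ∀ a ∈ Ioo 0 c, φ a = ∫ y, (y : ℝ) ^ a ∂(ρ : Measure unitInterval)

namespace IsMomentFn

variable {c : ℝ} {φ ψ : ℝ → ℝ}

lemma continuous_rpow_coe {a : ℝ} (ha : 0 < a) :
    Continuous fun y : unitInterval => (y : ℝ) ^ a :=
  continuous_subtype_val.rpow_const fun _ => Or.inr ha.le

lemma integrable_rpow_coe (ρ : Measure unitInterval) [IsFiniteMeasure ρ] {a : ℝ} (ha : 0 < a) :
    Integrable (fun y : unitInterval => (y : ℝ) ^ a) ρ :=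
  (continuous_rpow_coe ha).integrable_of_hasCompactSupport
    (HasCompactSupport.of_compactSpace _)

lemma congr (hφ : IsMomentFn c φ) (h : ∀ a ∈ Ioo 0 c, ψ a = φ a) : IsMomentFn c ψ := by
  obtain ⟨ρ, hρ⟩ := hφ
  exact ⟨ρ, fun a ha => (h a ha).trans (hρ a ha)⟩

lemma one (c : ℝ) : IsMomentFn c fun _ => 1 :=
  ⟨⟨Measure.dirac 1, inferInstance⟩, fun a _ => by simp⟩

lemma nonneg (hφ : IsMomentFn c φ) {a : ℝ} (ha : a ∈ Ioo 0 c) : 0 ≤ φ a := by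
  obtain ⟨ρ, hρ⟩ := hφ
  rw [hρ a ha]
  exact integral_nonneg fun y => rpow_nonneg y.2.1 _

lemma le_one (hφ : IsMomentFn c φ) {a : ℝ} (ha : a ∈ Ioo 0 c) : φ a ≤ 1 := by
  obtain ⟨ρ, hρ⟩ := hφ
  rw [hρ a ha]
  calc ∫ y, (y : ℝ) ^ a ∂(ρ : Measure unitInterval)
      ≤ ∫ _, 1 ∂(ρ : Measure unitInterval) :=
        integral_mono (integrable_rpow_coe _ ha.1) (integrable_const _)
          fun y => rpow_le_one y.2.1 y.2.2 ha.1.le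
    _ = 1 := by simp

lemma mul (hφ : IsMomentFn c φ) (hψ : IsMomentFn c ψ) : IsMomentFn c fun a => φ a * ψ a := by
  obtain ⟨ρ, hρ⟩ := hφ
  obtain ⟨σ, hσ⟩ := hψ
  have hm : Measurable fun p : unitInterval × unitInterval => p.1 * p.2 :=
    (continuous_fst.mul continuous_snd).measurable
  refine ⟨⟨((ρ : Measure unitInterval).prod σ).map fun p => p.1 * p.2,
    Measure.isProbabilityMeasure_map hm.aemeasurable⟩, fun a ha => ?_⟩
  simp only [ProbabilityMeasure.coe_mk]
  rw [integral_map hm.aemeasurable (continuous_rpow_coe ha.1).aestronglyMeasurable,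
    hρ a ha, hσ a ha, ← integral_prod_mul]
  refine integral_congr_ae (.of_forall fun p => ?_)
  exact (mul_rpow p.1.2.1 p.2.2.1).symm

lemma convexComb (hφ : IsMomentFn c φ) (hψ : IsMomentFn c ψ) {p : ℝ} (hp0 : 0 ≤ p) (hp1 : p ≤ 1) :
    IsMomentFn c fun a => (1 - p) * φ a + p * ψ a := by
  obtain ⟨ρ, hρ⟩ := hφ
  obtain ⟨σ, hσ⟩ := hψ
  refine ⟨⟨ENNReal.ofReal (1 - p) • (ρ : Measure unitInterval) +
    ENNReal.ofReal p • (σ : Measure unitInterval), ⟨?_⟩⟩, fun a ha => ?_⟩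
  · simp [← ENNReal.ofReal_add (sub_nonneg.2 hp1) hp0]
  · simp only [ProbabilityMeasure.coe_mk]
    rw [integral_add_measure
      ((integrable_rpow_coe _ ha.1).smul_measure ENNReal.ofReal_ne_top)
      ((integrable_rpow_coe _ ha.1).smul_measure ENNReal.ofReal_ne_top),
      integral_smul_measure, integral_smul_measure, hρ a ha, hσ a ha,
      ENNReal.toReal_ofReal (sub_nonneg.2 hp1), ENNReal.toReal_ofReal hp0, smul_eq_mul, smul_eq_mul]

lemma div_add {θ : ℝ} (hθ : 0 < θ) : IsMomentFn c fun a => θ / (θ + a) := by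
  have hmem (y : unitInterval) : (y : ℝ) ^ (1 / θ) ∈ unitInterval :=
    ⟨rpow_nonneg y.2.1 _, rpow_le_one y.2.1 y.2.2 (by positivity)⟩
  have hm : Measurable fun y : unitInterval => (⟨(y : ℝ) ^ (1 / θ), hmem y⟩ : unitInterval) :=
    ((continuous_rpow_coe (by positivity)).subtype_mk _).measurable
  refine ⟨⟨(volume : Measure unitInterval).map _,
    Measure.isProbabilityMeasure_map hm.aemeasurable⟩, fun a ha => ?_⟩
  simp only [ProbabilityMeasure.coe_mk]
  rw [integral_map hm.aemeasurable (continuous_rpow_coe ha.1).aestronglyMeasurable]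
  have h0 : 0 < a := ha.1
  have h1 : (∫ y : unitInterval, ((y : ℝ) ^ (1 / θ)) ^ a) = ∫ y in Icc (0 : ℝ) 1, y ^ (a / θ) := by
    rw [← integral_subtype_comap measurableSet_Icc]
    refine integral_congr_ae (.of_forall fun y => ?_)
    simp only
    rw [← rpow_mul y.2.1, one_div_mul_eq_div]
  rw [h1, integral_Icc_eq_integral_Ioc, ← intervalIntegral.integral_of_le zero_le_one,
    integral_rpow (Or.inl (by have : 0 < a / θ := by positivity
                              linarith)), one_rpow, zero_rpow (by positivity)]
  field_simp
  ring

open Filter Topology in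
lemma of_tendsto {f : ℕ → ℝ → ℝ} (hf : ∀ n, IsMomentFn c (f n))
    (h : ∀ a ∈ Ioo 0 c, Tendsto (fun n => f n a) atTop (𝓝 (φ a))) : IsMomentFn c φ := by
  choose ρ hρ using hf
  obtain ⟨σ, -, hσ⟩ := isCompact_univ.ultrafilter_le_nhds ((hyperfilter ℕ).map ρ) (by simp)
  refine ⟨σ, fun a ha => ?_⟩
  have hle : (hyperfilter ℕ : Filter ℕ) ≤ atTop := by
    rw [← Nat.cofinite_eq_atTop]; exact hyperfilter_le_cofinite
  have hσ' : Tendsto ρ (hyperfilter ℕ) (𝓝 σ) := hσ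
  have := (ProbabilityMeasure.tendsto_iff_forall_integral_tendsto.1 hσ')
    (BoundedContinuousFunction.mkOfCompact ⟨_, continuous_rpow_coe ha.1⟩)
  refine tendsto_nhds_unique ((h a ha).mono_left hle) (this.congr fun n => ?_)
  rw [hρ n a ha]
  rfl

open Filter Topology in
/-- If `φ` is the moment function of `e^{-T}`, then `(1 - p) / (1 + a / θ - p * φ a)` is the one
for the sum of an exponential time and, with probability `p`, a copy of `T` and a fresh start. -/
lemma resolvent (hφ : IsMomentFn c φ) {p θ : ℝ} (hp0 : 0 ≤ p) (hp1 : p < 1) (hθ : 0 < θ) :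
    IsMomentFn c fun a => (1 - p) / (1 + a / θ - p * φ a) := by
  let f : ℕ → ℝ → ℝ := fun n => Nat.rec (fun _ => 1)
    (fun _ g a => ((1 - p) * 1 + p * (φ a * g a)) * (θ / (θ + a))) n
  have hf : ∀ n, IsMomentFn c (f n) := by
    intro n
    induction n with
    | zero => exact one c
    | succ n ih => exact ((one c).convexComb (hφ.mul ih) hp0 hp1.le).mul (div_add hθ)
  refine of_tendsto hf fun a ha => ?_
  set L := (1 - p) / (1 + a / θ - p * φ a) with hL
  have h0 := hφ.nonneg ha
  have h1 := hφ.le_one ha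
  have ha0 := ha.1
  have hat : 0 < a / θ := div_pos ha0 hθ
  have hpos : 0 < 1 + a / θ - p * φ a := by nlinarith
  have hfix : L = ((1 - p) * 1 + p * (φ a * L)) * (θ / (θ + a)) := by
    have : L * (1 + a / θ - p * φ a) = 1 - p := div_mul_cancel₀ _ hpos.ne'
    field_simp at this ⊢
    linarith
  have hb : ∀ n, |f n a - L| ≤ p ^ n * |1 - L| := by
    intro n
    induction n with
    | zero => simp [f]
    | succ n ih =>
      have : f (n + 1) a - L = p * ((φ a * (θ / (θ + a))) * (f n a - L)) := by
        conv_lhs => rw [hfix]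
        change ((1 - p) * 1 + p * (φ a * f n a)) * (θ / (θ + a)) - _ = _
        ring
      have h2 : 0 ≤ θ / (θ + a) := by positivity
      have h3 : θ / (θ + a) ≤ 1 := by
        rw [div_le_one (by positivity)]; linarith
      have h4 : φ a * (θ / (θ + a)) ≤ 1 := mul_le_one₀ h1 h2 h3
      rw [this, abs_mul, abs_mul, abs_of_nonneg hp0, abs_of_nonneg (mul_nonneg h0 h2), pow_succ']
      calc p * (φ a * (θ / (θ + a)) * |f n a - L|) ≤ p * (1 * (p ^ n * |1 - L|)) := by gcongr
        _ = _ := by ring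
  rw [tendsto_iff_norm_sub_tendsto_zero]
  refine squeeze_zero (fun _ => norm_nonneg _) hb ?_
  simpa using (tendsto_pow_atTop_nhds_zero_of_lt_one hp0 hp1).mul_const |1 - L|

end IsMomentFn

/-- The (unnormalised) density of the beta law with parameters `a` and `c - a`. -/
noncomputable def betaWeight (c a u : ℝ) : ℝ := u ^ (a - 1) * (1 - u) ^ (c - a - 1)

/-- The integral of `g` over `(0, 1)` against the unnormalised beta density. -/
noncomputable def eulerIntegral (c a : ℝ) (g : ℝ → ℝ) : ℝ :=
  ∫ u in Ioo (0 : ℝ) 1, betaWeight c a u * g u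

lemma measurable_betaWeight (c a : ℝ) : Measurable (betaWeight c a) := by
  unfold betaWeight; fun_prop

lemma betaWeight_pos (c a : ℝ) {u : ℝ} (hu : u ∈ Ioo (0 : ℝ) 1) : 0 < betaWeight c a u :=
  mul_pos (rpow_pos_of_pos hu.1 _) (rpow_pos_of_pos (by linarith [hu.2]) _)

lemma integrableOn_betaWeight {c a : ℝ} (ha : a ∈ Ioo 0 c) :
    IntegrableOn (betaWeight c a) (Ioo 0 1) := by
  have h := (Complex.betaIntegral_convergent (u := (a : ℂ)) (v := ((c - a : ℝ) : ℂ))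
    (by simpa using ha.1) (by simpa using ha.2)).1.norm
  refine IntegrableOn.congr_fun (IntegrableOn.mono_set h Ioo_subset_Ioc_self)
    (fun u hu => ?_) measurableSet_Ioo
  have h1 : (u : ℂ) ^ ((a : ℂ) - 1) = ((u ^ (a - 1) : ℝ) : ℂ) := by
    rw [Complex.ofReal_cpow hu.1.le]; push_cast; rfl
  have h2 : (1 - (u : ℂ)) ^ (((c - a : ℝ) : ℂ) - 1) = (((1 - u) ^ (c - a - 1) : ℝ) : ℂ) := by
    rw [Complex.ofReal_cpow (by linarith [hu.2])]; push_cast; rfl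
  rw [h1, h2, ← Complex.ofReal_mul, Complex.norm_real, Real.norm_eq_abs]
  exact abs_of_pos (betaWeight_pos c a hu)

lemma integrableOn_betaWeight_mul {c a : ℝ} (ha : a ∈ Ioo 0 c) {g : ℝ → ℝ} (hg : Continuous g) :
    IntegrableOn (fun u => betaWeight c a u * g u) (Ioo 0 1) := by
  obtain ⟨C, hC⟩ := isCompact_Icc.exists_bound_of_continuousOn (s := Icc (0 : ℝ) 1) hg.continuousOn
  exact (integrableOn_betaWeight ha).mul_bdd (c := C) hg.aestronglyMeasurable
    ((ae_restrict_mem measurableSet_Ioo).mono fun u hu => hC u (Ioo_subset_Icc_self hu))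

lemma eulerIntegral_pos {c a : ℝ} (ha : a ∈ Ioo 0 c) {g : ℝ → ℝ} (hg : Continuous g)
    (hpos : ∀ u ∈ Ioo (0 : ℝ) 1, 0 < g u) : 0 < eulerIntegral c a g := by
  have h0 : ∀ u ∈ Ioo (0 : ℝ) 1, 0 < betaWeight c a u * g u := fun u hu =>
    mul_pos (betaWeight_pos c a hu) (hpos u hu)
  refine (setIntegral_pos_iff_support_of_nonneg_ae
    ((ae_restrict_mem measurableSet_Ioo).mono fun u hu => (h0 u hu).le)
    (integrableOn_betaWeight_mul ha hg)).2 ?_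
  have : Function.support (fun u => betaWeight c a u * g u) ∩ Ioo 0 1 = Ioo 0 1 :=
    inter_eq_right.2 fun u hu => (h0 u hu).ne'
  rw [this]
  simp

/-- Integration by parts against the beta density. -/
lemma eulerIntegral_by_parts {c a : ℝ} (ha : a ∈ Ioo 0 c) {g g' : ℝ → ℝ}
    (hg : ∀ u, HasDerivAt g (g' u) u) (hg' : Continuous g') :
    eulerIntegral c a (fun u => (a - c * u) * g u + u * (1 - u) * g' u) = 0 := by
  have hgc : Continuous g := continuous_iff_continuousAt.2 fun u => (hg u).continuousAt
  have hint := integrableOn_betaWeight_mul ha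
    (g := fun u => (a - c * u) * g u + u * (1 - u) * g' u) (by fun_prop)
  have hca : 0 < c - a := sub_pos.2 ha.2
  have h := intervalIntegral.integral_eq_sub_of_hasDerivAt_of_le (a := (0 : ℝ)) (b := 1)
    (f := fun u => u ^ a * (1 - u) ^ (c - a) * g u)
    (f' := fun u => betaWeight c a u * ((a - c * u) * g u + u * (1 - u) * g' u))
    zero_le_one ?_ ?_ ?_
  · rw [intervalIntegral.integral_of_le zero_le_one, integral_Ioc_eq_integral_Ioo] at h
    rw [eulerIntegral, h]
    simp [zero_rpow ha.1.ne', zero_rpow hca.ne']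
  · refine Continuous.continuousOn (Continuous.mul (Continuous.mul ?_ ?_) hgc)
    · exact continuous_id.rpow_const fun _ => Or.inr ha.1.le
    · exact (continuous_const.sub continuous_id).rpow_const fun _ => Or.inr hca.le
  · intro u hu
    have hu1 : 0 < 1 - u := sub_pos.2 hu.2
    have h1 : HasDerivAt (fun u : ℝ => u ^ a) (a * u ^ (a - 1)) u :=
      hasDerivAt_rpow_const (Or.inl hu.1.ne')
    have h2 : HasDerivAt (fun u : ℝ => (1 - u) ^ (c - a))
        (-1 * (c - a) * (1 - u) ^ (c - a - 1)) u :=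
      ((hasDerivAt_id u).const_sub 1).rpow_const (Or.inl hu1.ne')
    refine ((h1.fun_mul h2).fun_mul (hg u)).congr_deriv ?_
    have e1 : u ^ a = u ^ (a - 1) * u := by
      rw [← rpow_add_one hu.1.ne', sub_add_cancel]
    have e2 : (1 - u) ^ (c - a) = (1 - u) ^ (c - a - 1) * (1 - u) := by
      rw [← rpow_add_one hu1.ne', sub_add_cancel]
    rw [e1, e2, betaWeight]
    ring
  · rw [intervalIntegrable_iff_integrableOn_Ioo_of_le zero_le_one]
    exact hint

/-- The three-term recurrence in `n` of the hypergeometric integrals with `(1 + h u)ⁿ`. -/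
lemma eulerIntegral_recurrence {c a : ℝ} (ha : a ∈ Ioo 0 c) (h : ℝ) (n : ℕ) :
    (c + n) * eulerIntegral c a (fun u => (1 + h * u) ^ (n + 1)) =
      (c + n + n * (1 + h) + a * h) * eulerIntegral c a (fun u => (1 + h * u) ^ n) -
        n * (1 + h) * eulerIntegral c a (fun u => (1 + h * u) ^ (n - 1)) := by
  have hp := eulerIntegral_by_parts ha (g := fun u => (1 + h * u) ^ n)
    (g' := fun u => n * (1 + h * u) ^ (n - 1) * h) (fun u => by
      simpa using (((hasDerivAt_id' u).const_mul h).const_add 1).fun_pow n) (by fun_prop)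
  have hI (m : ℕ) := integrableOn_betaWeight_mul ha (g := fun u => (1 + h * u) ^ m) (by fun_prop)
  have hs : IntegrableOn (fun u => (c + n + n * (1 + h) + a * h) *
        (betaWeight c a u * (1 + h * u) ^ n) -
      n * (1 + h) * (betaWeight c a u * (1 + h * u) ^ (n - 1))) (Ioo 0 1) :=
    Integrable.sub ((hI n).const_mul _) ((hI (n - 1)).const_mul _)
  have key : h * eulerIntegral c a (fun u => (a - c * u) * (1 + h * u) ^ n +
        u * (1 - u) * (n * (1 + h * u) ^ (n - 1) * h)) =
      (c + n + n * (1 + h) + a * h) * eulerIntegral c a (fun u => (1 + h * u) ^ n) -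
        n * (1 + h) * eulerIntegral c a (fun u => (1 + h * u) ^ (n - 1)) -
        (c + n) * eulerIntegral c a (fun u => (1 + h * u) ^ (n + 1)) := by
    simp only [eulerIntegral]
    rw [← integral_const_mul, ← integral_const_mul, ← integral_const_mul, ← integral_const_mul,
      ← integral_sub ((hI n).const_mul _) ((hI (n - 1)).const_mul _),
      ← integral_sub hs ((hI (n + 1)).const_mul _)]
    refine integral_congr_ae (.of_forall fun u => ?_)
    rcases n with _ | n
    · simp; ring
    · simp only [Nat.add_sub_cancel]
      push_cast
      ring
  rw [hp, mul_zero] at key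
  linarith

lemma eulerIntegral_pow_pos {c a : ℝ} (ha : a ∈ Ioo 0 c) {h : ℝ} (hh : 0 < h) (n : ℕ) :
    0 < eulerIntegral c a (fun u => (1 + h * u) ^ n) :=
  eulerIntegral_pos ha (by fun_prop) fun u hu => by have := hu.1; positivity

lemma isMomentFn_eulerIntegral_succ {c h : ℝ} (hc : 0 < c) (hh : 0 < h) (n : ℕ) :
    IsMomentFn c fun a => eulerIntegral c a (fun u => (1 + h * u) ^ n) /
      eulerIntegral c a (fun u => (1 + h * u) ^ (n + 1)) := by
  induction n with
  | zero =>
    refine (IsMomentFn.div_add (div_pos hc hh)).congr fun a ha => ?_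
    have h0 := eulerIntegral_pow_pos ha hh 0
    have h1 := eulerIntegral_pow_pos ha hh 1
    have hr := eulerIntegral_recurrence ha h 0
    have := ha.1
    simp only [zero_add, Nat.cast_zero, zero_mul, add_zero, sub_zero] at hr h0 h1 ⊢
    rw [div_eq_div_iff h1.ne' (by positivity), div_add' _ _ _ hh.ne', div_mul_eq_mul_div, hr]
    ring
  | succ n ih =>
    set m : ℝ := ((n + 1 : ℕ) : ℝ) with hm
    have hm0 : 0 < m := by positivity
    have hS : 0 < c + m + m * (1 + h) := by positivity
    refine (ih.resolvent (p := m * (1 + h) / (c + m + m * (1 + h)))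
      (θ := (c + m + m * (1 + h)) / h) (by positivity)
      ((div_lt_one hS).2 (by linarith)) (by positivity)).congr fun a ha => ?_
    have h0 := eulerIntegral_pow_pos ha hh n
    have h1 := eulerIntegral_pow_pos ha hh (n + 1)
    have h2 := eulerIntegral_pow_pos ha hh (n + 1 + 1)
    have hr := eulerIntegral_recurrence ha h (n + 1)
    rw [Nat.add_sub_cancel, ← hm] at hr
    set A := eulerIntegral c a (fun u => (1 + h * u) ^ n)
    set B := eulerIntegral c a (fun u => (1 + h * u) ^ (n + 1))
    set D := eulerIntegral c a (fun u => (1 + h * u) ^ (n + 1 + 1))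
    have hcm : 0 < c + m := by positivity
    have e : 1 + a / ((c + m + m * (1 + h)) / h) - m * (1 + h) / (c + m + m * (1 + h)) * (A / B) =
        (c + m) * D / ((c + m + m * (1 + h)) * B) := by
      rw [hr]
      field_simp
    rw [e]
    field_simp
    ring

lemma isMomentFn_eulerIntegral_pow {c h : ℝ} (hc : 0 < c) (hh : 0 < h) {m n : ℕ} (hmn : m ≤ n) :
    IsMomentFn c fun a => eulerIntegral c a (fun u => (1 + h * u) ^ m) /
      eulerIntegral c a (fun u => (1 + h * u) ^ n) := by
  induction n, hmn using Nat.le_induction with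
  | base =>
    exact (IsMomentFn.one c).congr fun a ha => div_self (eulerIntegral_pow_pos ha hh m).ne'
  | succ n _ ih =>
    refine (ih.mul (isMomentFn_eulerIntegral_succ hc hh n)).congr fun a ha => ?_
    rw [div_mul_div_cancel₀ (eulerIntegral_pow_pos ha hh n).ne']

open Filter Topology in
lemma tendsto_one_add_div_pow_floor {β : ℝ} (hβ : 0 ≤ β) (u : ℝ) :
    Tendsto (fun x : ℝ => (1 + x⁻¹ * u) ^ ⌊β * x⌋₊) atTop (𝓝 (exp (β * u))) := by
  have h1 : Tendsto (fun x : ℝ => x * log (1 + x⁻¹ * u)) atTop (𝓝 u) := by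
    refine tendsto_mul_log_one_add_of_tendsto (tendsto_const_nhds.congr' ?_)
    filter_upwards [eventually_gt_atTop 0] with x hx
    field_simp
  have h2 := ((tendsto_nat_floor_mul_div_atTop hβ).mul h1).rexp
  have h3 : Tendsto (fun x : ℝ => 1 + x⁻¹ * u) atTop (𝓝 1) := by
    simpa using (tendsto_inv_atTop_zero.mul_const u).const_add (1 : ℝ)
  refine h2.congr' ?_
  filter_upwards [eventually_gt_atTop 0, h3.eventually_const_lt zero_lt_one] with x hx hpos
  rw [← mul_assoc, div_mul_cancel₀ _ hx.ne', exp_nat_mul, exp_log hpos]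

open Filter Topology in
lemma tendsto_eulerIntegral_pow_floor {c a β : ℝ} (ha : a ∈ Ioo 0 c) (hβ : 0 ≤ β) :
    Tendsto (fun N : ℕ => eulerIntegral c a
        (fun u => (1 + ((N : ℝ) + 1)⁻¹ * u) ^ ⌊β * ((N : ℝ) + 1)⌋₊)) atTop
      (𝓝 (eulerIntegral c a fun u => exp (β * u))) := by
  have hN : Tendsto (fun N : ℕ => (N : ℝ) + 1) atTop atTop :=
    tendsto_natCast_atTop_atTop.atTop_add tendsto_const_nhds
  refine tendsto_integral_of_dominated_convergence (fun u => betaWeight c a u * exp β)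
    (fun N => ((measurable_betaWeight c a).mul (by fun_prop)).aestronglyMeasurable)
    ((integrableOn_betaWeight ha).mul_const _) (fun N => ?_) (.of_forall fun u =>
      ((tendsto_one_add_div_pow_floor hβ u).comp hN).const_mul _)
  refine (ae_restrict_mem measurableSet_Ioo).mono fun u hu => ?_
  have hu0 := hu.1
  have hw := betaWeight_pos c a hu
  have hx : (0 : ℝ) < (N : ℝ) + 1 := by positivity
  rw [norm_of_nonneg (by positivity)]
  gcongr
  calc (1 + ((N : ℝ) + 1)⁻¹ * u) ^ ⌊β * ((N : ℝ) + 1)⌋₊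
      ≤ exp (((N : ℝ) + 1)⁻¹ * u) ^ ⌊β * ((N : ℝ) + 1)⌋₊ := by
        gcongr
        rw [add_comm]
        exact add_one_le_exp _
    _ = exp (⌊β * ((N : ℝ) + 1)⌋₊ * (((N : ℝ) + 1)⁻¹ * u)) := (exp_nat_mul _ _).symm
    _ ≤ exp (β * ((N : ℝ) + 1) * (((N : ℝ) + 1)⁻¹ * 1)) := by
        gcongr
        · exact Nat.floor_le (by positivity)
        · exact hu.2.le
    _ = exp β := by congr 1; field_simp

lemma eulerIntegral_exp_pos {c a : ℝ} (ha : a ∈ Ioo 0 c) (β : ℝ) :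
    0 < eulerIntegral c a fun u => exp (β * u) :=
  eulerIntegral_pos ha (by fun_prop) fun _ _ => exp_pos _

/-- The Gamma factors of `Φ` cancel, so `Φ(a, c; β) / Φ(a, c; γ)` is, as a function of `a`,
the Laplace transform of a possibly defective positive random variable. -/
theorem isMomentFn_eulerIntegral_exp {c β γ : ℝ} (hc : 0 < c) (hβ : 0 ≤ β) (hβγ : β ≤ γ) :
    IsMomentFn c fun a => eulerIntegral c a (fun u => exp (β * u)) /
      eulerIntegral c a (fun u => exp (γ * u)) := by
  refine IsMomentFn.of_tendsto (fun N : ℕ => isMomentFn_eulerIntegral_pow hc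
    (h := ((N : ℝ) + 1)⁻¹) (by positivity) (m := ⌊β * ((N : ℝ) + 1)⌋₊)
    (n := ⌊γ * ((N : ℝ) + 1)⌋₊) (Nat.floor_le_floor (by gcongr))) fun a ha => ?_
  exact (tendsto_eulerIntegral_pow_floor ha hβ).div
    (tendsto_eulerIntegral_pow_floor ha (hβ.trans hβγ)) (eulerIntegral_exp_pos ha γ).ne'

lemma not_integrableOn_betaWeight_of_nonpos {c a : ℝ} (ha : a ≤ 0) :
    ¬ IntegrableOn (betaWeight c a) (Ioo 0 1) := by
  intro h
  have h1 : IntegrableOn (betaWeight c a) (Ioc 0 (1 / 2)) :=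
    h.mono_set fun u hu => ⟨hu.1, by linarith [hu.2]⟩
  rw [← integrableOn_Icc_iff_integrableOn_Ioc] at h1
  have hc : ContinuousOn (fun u : ℝ => (1 - u) ^ (-(c - a - 1))) (Icc 0 (1 / 2)) :=
    (continuousOn_const.sub continuousOn_id).rpow_const fun u hu => Or.inl (by
      have := hu.2; exact (by simp only [id_eq]; linarith : 0 < 1 - id u).ne')
  have h2 := (h1.mul_continuousOn hc isCompact_Icc).mono_set Ioo_subset_Icc_self
  have h3 : IntegrableOn (fun u : ℝ => u ^ (a - 1)) (Ioo 0 (1 / 2)) := by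
    refine h2.congr_fun (fun u hu => ?_) measurableSet_Ioo
    have hu1 : 0 < 1 - u := by linarith [hu.2]
    simp only [betaWeight]
    rw [mul_assoc, ← rpow_add hu1, add_neg_cancel, rpow_zero, mul_one]
  rw [intervalIntegral.integrableOn_Ioo_rpow_iff (by norm_num)] at h3
  linarith

lemma not_integrableOn_betaWeight {c a : ℝ} (ha : a ∉ Ioo 0 c) :
    ¬ IntegrableOn (betaWeight c a) (Ioo 0 1) := by
  by_cases h0 : a ≤ 0
  · exact not_integrableOn_betaWeight_of_nonpos h0
  intro h
  have hca : c - a ≤ 0 := by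
    by_contra! hlt
    exact ha ⟨not_le.1 h0, by linarith⟩
  refine not_integrableOn_betaWeight_of_nonpos (c := c) hca ?_
  rw [← intervalIntegrable_iff_integrableOn_Ioo_of_le zero_le_one] at h ⊢
  have h1 := (h.comp_sub_left 1).symm
  rw [sub_self, sub_zero] at h1
  refine h1.congr fun u _ => ?_
  simp only [betaWeight]
  rw [sub_sub_cancel, mul_comm, sub_sub_cancel]

lemma eulerIntegral_exp_eq_zero {c a : ℝ} (ha : a ∉ Ioo 0 c) (β : ℝ) :
    eulerIntegral c a (fun u => exp (β * u)) = 0 := by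
  refine integral_undef fun h => not_integrableOn_betaWeight ha ?_
  have h1 : IntegrableOn (fun u => betaWeight c a u * exp (β * u)) (Icc 0 1) := by
    rwa [integrableOn_Icc_iff_integrableOn_Ioo]
  have h2 := (h1.mul_continuousOn (g' := fun u => exp (-(β * u))) (by fun_prop)
    isCompact_Icc).mono_set Ioo_subset_Icc_self
  refine h2.congr_fun (fun u _ => ?_) measurableSet_Ioo
  simp only
  rw [mul_assoc, ← exp_add, add_neg_cancel, exp_zero, mul_one]

/-- The measure on `(0, 1)` with density `u^(ν - 1) e^(β u)`. -/
noncomputable def expBeta (ν β : ℝ) : Measure ℝ :=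
  (volume.restrict (Ioo 0 1)).withDensity
    fun u => ENNReal.ofReal (betaWeight (ν + 1) ν u * exp (β * u))

lemma measurable_expBeta_density (ν β : ℝ) :
    Measurable fun u => ENNReal.ofReal (betaWeight (ν + 1) ν u * exp (β * u)) :=
  ((measurable_betaWeight _ _).mul (by fun_prop)).ennreal_ofReal

lemma integral_expBeta (ν β : ℝ) (f : ℝ → ℝ) :
    ∫ u, f u ∂(expBeta ν β) =
      ∫ u in Ioo (0 : ℝ) 1, betaWeight (ν + 1) ν u * exp (β * u) * f u := by
  rw [expBeta, integral_withDensity_eq_integral_toReal_smul (measurable_expBeta_density ν β)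
    (.of_forall fun u => ENNReal.ofReal_lt_top)]
  refine setIntegral_congr_fun measurableSet_Ioo fun u hu => ?_
  have := betaWeight_pos (ν + 1) ν hu
  simp only [smul_eq_mul]
  rw [ENNReal.toReal_ofReal (by positivity)]

lemma expBeta_univ {ν : ℝ} (hν : 0 < ν) (β : ℝ) :
    expBeta ν β univ = ENNReal.ofReal (eulerIntegral (ν + 1) ν fun u => exp (β * u)) := by
  rw [expBeta, withDensity_apply _ MeasurableSet.univ, Measure.restrict_univ, eulerIntegral,
    ofReal_integral_eq_lintegral_ofReal]
  · exact integrableOn_betaWeight_mul ⟨hν, by linarith⟩ (by fun_prop)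
  · exact (ae_restrict_mem measurableSet_Ioo).mono fun u hu =>
      mul_nonneg (betaWeight_pos _ _ hu).le (exp_pos _).le

lemma expBeta_univ_ne_zero {ν : ℝ} (hν : 0 < ν) (β : ℝ) : expBeta ν β univ ≠ 0 := by
  rw [expBeta_univ hν]
  exact (ENNReal.ofReal_pos.2 (eulerIntegral_exp_pos ⟨hν, by linarith⟩ β)).ne'

lemma expBeta_univ_ne_top {ν : ℝ} (hν : 0 < ν) (β : ℝ) : expBeta ν β univ ≠ ⊤ := by
  rw [expBeta_univ hν]
  exact ENNReal.ofReal_ne_top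

lemma ae_expBeta_mem (ν β : ℝ) : ∀ᵐ u ∂(expBeta ν β), u ∈ Ioo (0 : ℝ) 1 :=
  (withDensity_absolutelyContinuous _ _).ae_le (ae_restrict_mem measurableSet_Ioo)

lemma lintegral_eq_mul_lintegral_comp_affine {β : ℝ} (hβ : 0 < β) {G : ℝ → ENNReal}
    (hG : Measurable G) :
    ∫⁻ x, G x = ENNReal.ofReal β * ∫⁻ u, G (β * (1 - u)) := by
  rw [lintegral_sub_left_eq_self (fun v => G (β * v)) 1]
  conv_lhs => rw [← Real.smul_map_volume_mul_left hβ.ne', abs_of_pos hβ]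
  rw [lintegral_smul_measure, lintegral_map hG (by fun_prop), smul_eq_mul]

/-- The substitution `z = α / (1 - u)` turns the unnormalised tilted inverse-gamma law into a
multiple of the law with density `u^(ν - 1) e^(u / (2α))` on `(0, 1)`. -/
lemma withDensity_invGammaLaw {ν α : ℝ} (hν : 0 < ν) (hα : 0 < α) :
    ∃ C : ENNReal, C ≠ 0 ∧ C ≠ ⊤ ∧ (invGammaLaw ν).withDensity
      (fun z => ENNReal.ofReal (if α < z then (z - α) ^ (ν - 1) else 0)) =
        C • (expBeta ν (1 / (2 * α))).map fun u => α / (1 - u) := by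
  set β : ℝ := 1 / (2 * α) with hβ
  have hβ0 : 0 < β := by positivity
  have hΓ := Gamma_pos_of_pos hν
  set K : ℝ := (Gamma ν)⁻¹ * (1 / 2) ^ (ν - 1) * exp (-β) with hK
  have hK0 : 0 < K := by positivity
  refine ⟨ENNReal.ofReal β * ENNReal.ofReal K, by simp [hβ0, hK0],
    ENNReal.mul_ne_top ENNReal.ofReal_ne_top ENNReal.ofReal_ne_top, ?_⟩
  have hd : Measurable fun z : ℝ => ENNReal.ofReal (if α < z then (z - α) ^ (ν - 1) else 0) :=
    (Measurable.ite measurableSet_Ioi (by fun_prop) measurable_const).ennreal_ofReal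
  have hg : Measurable fun x : ℝ => 1 / (2 * x) := by fun_prop
  have hg' : Measurable fun u : ℝ => α / (1 - u) := by fun_prop
  have hpdf : Measurable (gammaPDF ν 1) := (measurable_gammaPDFReal ν 1).ennreal_ofReal
  refine Measure.ext_of_lintegral _ fun f hf => ?_
  have hdf : Measurable fun x : ℝ => ((fun z : ℝ =>
      ENNReal.ofReal (if α < z then (z - α) ^ (ν - 1) else 0)) * f) (1 / (2 * x)) :=
    (hd.mul hf).comp hg
  have hfg : Measurable fun u : ℝ => f (α / (1 - u)) := hf.comp hg'
  rw [lintegral_withDensity_eq_lintegral_mul _ hd hf, invGammaLaw,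
    lintegral_map (hd.mul hf) hg, gammaMeasure,
    lintegral_withDensity_eq_lintegral_mul _ hpdf hdf,
    lintegral_eq_mul_lintegral_comp_affine hβ0 (hpdf.mul hdf),
    lintegral_smul_measure, lintegral_map hf hg', expBeta,
    lintegral_withDensity_eq_lintegral_mul _ (measurable_expBeta_density ν β) hfg,
    smul_eq_mul, mul_assoc, ← lintegral_const_mul _
      ((measurable_expBeta_density ν β).mul hfg),
    ← lintegral_indicator measurableSet_Ioo]
  congr 1
  refine lintegral_congr fun u => ?_
  have hz : 1 / (2 * (β * (1 - u))) = α / (1 - u) := by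
    rw [hβ, ← mul_assoc, mul_one_div, div_mul_eq_mul_div, one_div_div]
    rw [mul_div_mul_left _ _ two_ne_zero]
  simp only [Pi.mul_apply, hz]
  by_cases hu : u ∈ Ioo (0 : ℝ) 1
  · have hu0 := hu.1
    have hu1 : 0 < 1 - u := sub_pos.2 hu.2
    have hlt : α < α / (1 - u) := by rw [lt_div_iff₀ hu1]; nlinarith
    have hx : 0 < β * (1 - u) := by positivity
    rw [indicator_of_mem hu, if_pos hlt, gammaPDF, gammaPDFReal, if_pos hx.le,
      ← mul_assoc (ENNReal.ofReal _), ← mul_assoc (ENNReal.ofReal K),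
      ← ENNReal.ofReal_mul (by positivity), ← ENNReal.ofReal_mul hK0.le]
    congr 2
    have e1 : α / (1 - u) - α = α * u / (1 - u) := by field_simp; ring
    have e2 : (β * (1 - u)) ^ (ν - 1) * (α * u / (1 - u)) ^ (ν - 1) =
        (1 / 2) ^ (ν - 1) * u ^ (ν - 1) := by
      rw [← mul_rpow hx.le (by positivity), ← mul_rpow (by positivity) hu0.le]
      congr 1
      rw [hβ]
      field_simp
    have e3 : exp (-(1 * (β * (1 - u)))) = exp (-β) * exp (β * u) := by
      rw [← exp_add]; congr 1; ring
    have e4 : betaWeight (ν + 1) ν u = u ^ (ν - 1) := by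
      simp [betaWeight]
    rw [e1, e3, e4, one_rpow, hK]
    calc 1 / Gamma ν * (β * (1 - u)) ^ (ν - 1) * (exp (-β) * exp (β * u)) *
          (α * u / (1 - u)) ^ (ν - 1)
        = (Gamma ν)⁻¹ * ((β * (1 - u)) ^ (ν - 1) * (α * u / (1 - u)) ^ (ν - 1)) *
          exp (-β) * exp (β * u) := by ring
      _ = _ := by rw [e2]; ring
  · rw [indicator_of_notMem hu]
    by_cases hu1 : 1 < u
    · have hx : ¬ 0 ≤ β * (1 - u) := by nlinarith
      simp [gammaPDF, gammaPDFReal, hx]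
    · have hle : ¬ α < α / (1 - u) := by
        rcases eq_or_lt_of_le (not_lt.1 hu1) with rfl | h1
        · simpa using hα.le
        · have hu0 : u ≤ 0 := not_lt.1 fun h => hu ⟨h, h1⟩
          rw [not_lt, div_le_iff₀ (by linarith)]
          nlinarith
      simp [hle]

lemma tiltedInvGamma_eq {ν α : ℝ} (hν : 0 < ν) (hα : 0 < α) :
    tiltedInvGamma ν α = (expBeta ν (1 / (2 * α)) univ)⁻¹ •
      (expBeta ν (1 / (2 * α))).map fun u => α / (1 - u) := by
  obtain ⟨C, hC0, hCt, h⟩ := withDensity_invGammaLaw hν hα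
  have hm : Measurable fun u : ℝ => α / (1 - u) := by fun_prop
  rw [tiltedInvGamma, h, Measure.smul_apply, Measure.map_apply hm MeasurableSet.univ,
    preimage_univ, smul_smul, smul_eq_mul,
    ENNReal.mul_inv (Or.inl hC0) (Or.inl hCt), mul_right_comm, ENNReal.inv_mul_cancel hC0 hCt,
    one_mul]

lemma isProbabilityMeasure_tiltedInvGamma {ν α : ℝ} (hν : 0 < ν) (hα : 0 < α) :
    IsProbabilityMeasure (tiltedInvGamma ν α) := by
  have hm : Measurable fun u : ℝ => α / (1 - u) := by fun_prop
  refine ⟨?_⟩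
  rw [tiltedInvGamma_eq hν hα, Measure.smul_apply, Measure.map_apply hm MeasurableSet.univ,
    preimage_univ, smul_eq_mul,
    ENNReal.inv_mul_cancel (expBeta_univ_ne_zero hν _) (expBeta_univ_ne_top hν _)]

lemma ae_lt_tiltedInvGamma {ν α : ℝ} (hν : 0 < ν) (hα : 0 < α) :
    ∀ᵐ z ∂(tiltedInvGamma ν α), 0 < z / α - 1 := by
  have hm : Measurable fun u : ℝ => α / (1 - u) := by fun_prop
  rw [tiltedInvGamma_eq hν hα]
  refine Measure.ae_smul_measure ?_ _
  rw [ae_map_iff hm.aemeasurable (measurableSet_lt measurable_const (by fun_prop))]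
  filter_upwards [ae_expBeta_mem ν (1 / (2 * α))] with u hu
  have hu1 : 0 < 1 - u := sub_pos.2 hu.2
  have : α / (1 - u) / α - 1 = u / (1 - u) := by field_simp; ring
  rw [this]
  exact div_pos hu.1 hu1

lemma mgf_log_tiltedInvGamma {ν α : ℝ} (hν : 0 < ν) (hα : 0 < α) (t : ℝ) :
    mgf (fun z => log (z / α - 1)) (tiltedInvGamma ν α) t =
      eulerIntegral (ν + 1) (ν + t) (fun u => exp (1 / (2 * α) * u)) /
        eulerIntegral (ν + 1) ν (fun u => exp (1 / (2 * α) * u)) := by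
  have hm : Measurable fun u : ℝ => α / (1 - u) := by fun_prop
  have hlog : Measurable fun z : ℝ => log (z / α - 1) := measurable_log.comp (by fun_prop)
  rw [mgf, tiltedInvGamma_eq hν hα, integral_smul_measure,
    integral_map hm.aemeasurable (hlog.const_mul t).exp.aestronglyMeasurable, integral_expBeta,
    expBeta_univ hν,
    ENNReal.toReal_inv,
    ENNReal.toReal_ofReal (eulerIntegral_exp_pos ⟨hν, by linarith⟩ _).le, smul_eq_mul,
    inv_mul_eq_div]
  congr 1
  refine setIntegral_congr_fun measurableSet_Ioo fun u hu => ?_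
  have hu0 := hu.1
  have hu1 : 0 < 1 - u := sub_pos.2 hu.2
  have e : α / (1 - u) / α - 1 = u / (1 - u) := by field_simp; ring
  have e1 : exp (t * log (u / (1 - u))) = u ^ t * (1 - u) ^ (-t) := by
    rw [mul_comm, ← rpow_def_of_pos (by positivity), div_rpow hu0.le hu1.le, rpow_neg hu1.le]
    rfl
  have e2 : betaWeight (ν + 1) (ν + t) u = betaWeight (ν + 1) ν u * (u ^ t * (1 - u) ^ (-t)) := by
    have h1 : ν + t - 1 = ν - 1 + t := by ring
    have h2 : ν + 1 - (ν + t) - 1 = ν + 1 - ν - 1 + -t := by ring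
    rw [betaWeight, betaWeight, h1, h2, rpow_add hu0, rpow_add hu1]
    ring
  simp only
  rw [e, e1, e2]
  ring

/-- Size-biasing by `y ^ ν` turns a moment function into the moment generating function of the
logarithm of a random variable with values in `(0, 1]`. -/
lemma IsMomentFn.exists_mgf_log {ν : ℝ} (hν : 0 < ν) {φ : ℝ → ℝ} (hφ : IsMomentFn (ν + 1) φ)
    (hpos : 0 < φ ν) :
    ∃ (η : Measure unitInterval) (Y : unitInterval → ℝ), IsProbabilityMeasure η ∧ Measurable Y ∧
      (∀ y, Y y ∈ Ioc (0 : ℝ) 1) ∧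
      ∀ t, ν + t ∈ Ioo 0 (ν + 1) → mgf (fun y => log (Y y)) η t = φ (ν + t) / φ ν := by
  obtain ⟨ρ, hρ⟩ := hφ
  have hνmem : ν ∈ Ioo 0 (ν + 1) := ⟨hν, by linarith⟩
  have hw : Measurable fun y : unitInterval => ENNReal.ofReal ((y : ℝ) ^ ν) :=
    (continuous_rpow_coe hν).measurable.ennreal_ofReal
  have hYm : Measurable fun y : unitInterval => if 0 < (y : ℝ) then (y : ℝ) else 1 :=
    Measurable.ite (measurableSet_lt measurable_const measurable_subtype_coe)
      measurable_subtype_coe measurable_const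
  refine ⟨(ENNReal.ofReal (φ ν))⁻¹ • (ρ : Measure unitInterval).withDensity
    fun y => ENNReal.ofReal ((y : ℝ) ^ ν), fun y => if 0 < (y : ℝ) then (y : ℝ) else 1,
    ⟨?_⟩, hYm, fun y => ?_, fun t ht => ?_⟩
  · rw [Measure.smul_apply, withDensity_apply _ MeasurableSet.univ, Measure.restrict_univ,
      ← ofReal_integral_eq_lintegral_ofReal (integrable_rpow_coe _ hν)
        (.of_forall fun y => rpow_nonneg y.2.1 _), ← hρ ν hνmem, smul_eq_mul,
      ENNReal.inv_mul_cancel (ENNReal.ofReal_pos.2 hpos).ne' ENNReal.ofReal_ne_top]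
  · simp only
    split_ifs with h
    · exact ⟨h, y.2.2⟩
    · simp
  · rw [mgf, integral_smul_measure, integral_withDensity_eq_integral_toReal_smul hw
      (.of_forall fun _ => ENNReal.ofReal_lt_top), ENNReal.toReal_inv,
      ENNReal.toReal_ofReal hpos.le, smul_eq_mul, inv_mul_eq_div, hρ _ ht]
    congr 1
    refine integral_congr_ae (.of_forall fun y => ?_)
    simp only [smul_eq_mul]
    rw [ENNReal.toReal_ofReal (rpow_nonneg y.2.1 _)]
    split_ifs with h
    · rw [mul_comm t, ← rpow_def_of_pos h, rpow_add h]
    · have : (y : ℝ) = 0 := le_antisymm (not_lt.1 h) y.2.1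
      rw [this, zero_rpow hν.ne', zero_rpow ht.1.ne', zero_mul]

/-- Two real random variables with the same moment generating function, finite around `0`,
have the same law. -/
lemma map_eq_map_of_mgf_eq {Ω Ω' : Type*} {_ : MeasurableSpace Ω} {_ : MeasurableSpace Ω'}
    {P : Measure Ω} {P' : Measure Ω'} [IsProbabilityMeasure P] [IsProbabilityMeasure P']
    {X : Ω → ℝ} {X' : Ω' → ℝ} (hX : AEMeasurable X P) (hX' : AEMeasurable X' P')
    (h0 : 0 ∈ interior (integrableExpSet X P)) (h : mgf X P = mgf X' P') :
    P.map X = P'.map X' := by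
  have := Measure.isProbabilityMeasure_map hX
  have := Measure.isProbabilityMeasure_map hX'
  refine Measure.ext_of_charFun (funext fun t => ?_)
  rw [← complexMGF_mul_I hX, ← complexMGF_mul_I hX']
  exact eqOn_complexMGF_of_mgf h (by simpa using h0)

/-- Positive random variables whose logarithms have the same law have the same law. -/
lemma map_eq_map_of_log {Ω Ω' : Type*} {_ : MeasurableSpace Ω} {_ : MeasurableSpace Ω'}
    {P : Measure Ω} {P' : Measure Ω'} {X : Ω → ℝ} {X' : Ω' → ℝ} (hX : Measurable X)
    (hX' : Measurable X') (hpos : ∀ᵐ ω ∂P, 0 < X ω) (hpos' : ∀ᵐ ω ∂P', 0 < X' ω)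
    (h : P.map (fun ω => log (X ω)) = P'.map fun ω => log (X' ω)) : P.map X = P'.map X' := by
  have e := congrArg (Measure.map exp) h
  rw [Measure.map_map measurable_exp hX.log, Measure.map_map measurable_exp hX'.log] at e
  rwa [Measure.map_congr (f := exp ∘ fun ω => log (X ω)) (g := X)
      (hpos.mono fun ω hω => exp_log hω),
    Measure.map_congr (f := exp ∘ fun ω => log (X' ω)) (g := X')
      (hpos'.mono fun ω hω => exp_log hω)] at e

theorem stmt17 (ν b c : ℝ) (hν : 0 < ν) (hc : 0 < c) (hcb : c < b) :
    ∃ (Ω : Type) (_ : MeasurableSpace Ω) (P : Measure Ω) (Zb Zc Y : Ω → ℝ),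
      IsProbabilityMeasure P ∧ Measurable Zb ∧ Measurable Zc ∧ Measurable Y ∧
      Measure.map Zb P = tiltedInvGamma ν b ∧
      Measure.map Zc P = tiltedInvGamma ν c ∧
      (∀ ω, Y ω ∈ Set.Ioc (0:ℝ) 1) ∧ IndepFun Y Zc P ∧
      Measure.map (fun ω => Zb ω / b - 1) P
        = Measure.map (fun ω => Y ω * (Zc ω / c - 1)) P := by
  have hb : 0 < b := hc.trans hcb
  have hνmem : ν ∈ Ioo 0 (ν + 1) := ⟨hν, by linarith⟩
  have hF (α : ℝ) {a : ℝ} (ha : a ∈ Ioo 0 (ν + 1)) := eulerIntegral_exp_pos ha (1 / (2 * α))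
  obtain ⟨η, Y, hη, hYm, hY, hmgf⟩ := IsMomentFn.exists_mgf_log hν
    (isMomentFn_eulerIntegral_exp (c := ν + 1) (β := 1 / (2 * b)) (γ := 1 / (2 * c))
      (by positivity) (by positivity) (by gcongr)) (div_pos (hF b hνmem) (hF c hνmem))
  have := isProbabilityMeasure_tiltedInvGamma hν hb
  have := isProbabilityMeasure_tiltedInvGamma hν hc
  let P := (tiltedInvGamma ν c).prod (η.prod (tiltedInvGamma ν b))
  have mb : MeasurePreserving (fun ω : ℝ × unitInterval × ℝ => ω.2.2) P (tiltedInvGamma ν b) :=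
    measurePreserving_snd.comp measurePreserving_snd
  have mc : MeasurePreserving Prod.fst P (tiltedInvGamma ν c) := measurePreserving_fst
  have my : MeasurePreserving (fun ω : ℝ × unitInterval × ℝ => ω.2.1) P η :=
    measurePreserving_fst.comp measurePreserving_snd
  have hYm' : Measurable fun ω : ℝ × unitInterval × ℝ => Y ω.2.1 := hYm.comp my.measurable
  have hind : IndepFun (fun ω : ℝ × unitInterval × ℝ => Y ω.2.1) Prod.fst P :=
    (indepFun_prod measurable_id (hYm.comp measurable_fst)).symm
  refine ⟨ℝ × unitInterval × ℝ, inferInstance, P, fun ω => ω.2.2, Prod.fst, fun ω => Y ω.2.1,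
    inferInstance, mb.measurable, mc.measurable, hYm', mb.map_eq, mc.map_eq, fun ω => hY _,
    hind, ?_⟩
  have hposb := mb.quasiMeasurePreserving.ae (ae_lt_tiltedInvGamma hν hb)
  have hposc := mc.quasiMeasurePreserving.ae (ae_lt_tiltedInvGamma hν hc)
  have hmb : Measurable fun ω : ℝ × unitInterval × ℝ => ω.2.2 / b - 1 := by fun_prop
  have hmc : Measurable fun ω : ℝ × unitInterval × ℝ => ω.1 / c - 1 := by fun_prop
  refine map_eq_map_of_log hmb (hYm'.mul hmc) hposb
    (hposc.mono fun ω hω => mul_pos (hY _).1 hω) ?_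
  have hlog : (fun ω : ℝ × unitInterval × ℝ => log (Y ω.2.1 * (ω.1 / c - 1))) =ᵐ[P]
      (fun ω => log (Y ω.2.1)) + fun ω => log (ω.1 / c - 1) :=
    hposc.mono fun ω hω => log_mul (hY _).1.ne' hω.ne'
  rw [Measure.map_congr hlog]
  have hl (α : ℝ) : Measurable fun z : ℝ => log (z / α - 1) := measurable_log.comp (by fun_prop)
  have hmgfb (t : ℝ) : mgf (fun ω : ℝ × unitInterval × ℝ => log (ω.2.2 / b - 1)) P t =
      mgf (fun z => log (z / b - 1)) (tiltedInvGamma ν b) t := by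
    rw [← mb.map_eq, mgf_map mb.measurable.aemeasurable
      ((hl b).const_mul t).exp.aestronglyMeasurable]
    rfl
  have hmgfc (t : ℝ) : mgf (fun ω : ℝ × unitInterval × ℝ => log (ω.1 / c - 1)) P t =
      mgf (fun z => log (z / c - 1)) (tiltedInvGamma ν c) t := by
    rw [← mc.map_eq, mgf_map mc.measurable.aemeasurable
      ((hl c).const_mul t).exp.aestronglyMeasurable]
    rfl
  have hmgfy (t : ℝ) : mgf (fun ω : ℝ × unitInterval × ℝ => log (Y ω.2.1)) P t =
      mgf (fun y => log (Y y)) η t := by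
    rw [← my.map_eq, mgf_map my.measurable.aemeasurable
      (hYm.log.const_mul t).exp.aestronglyMeasurable]
    rfl
  have hind' : IndepFun (fun ω : ℝ × unitInterval × ℝ => log (Y ω.2.1))
      (fun ω => log (ω.1 / c - 1)) P := hind.comp measurable_log (hl c)
  refine map_eq_map_of_mgf_eq hmb.log.aemeasurable (hYm'.log.add hmc.log).aemeasurable
    ?_ (funext fun t => ?_)
  · refine mem_interior.2 ⟨Ioo (-ν) 1, fun t ht => ?_, isOpen_Ioo, by simpa using hν⟩
    refine mgf_pos_iff.1 ?_
    rw [hmgfb, mgf_log_tiltedInvGamma hν hb]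
    exact div_pos (hF b ⟨by linarith [ht.1], by linarith [ht.2]⟩) (hF b hνmem)
  · rw [IndepFun.mgf_add hind'
      (hYm'.log.const_mul t).exp.aestronglyMeasurable
      (hmc.log.const_mul t).exp.aestronglyMeasurable, hmgfb, hmgfc, hmgfy,
      mgf_log_tiltedInvGamma hν hb, mgf_log_tiltedInvGamma hν hc]
    by_cases ht : ν + t ∈ Ioo 0 (ν + 1)
    · rw [hmgf t ht]
      have h1 := hF b hνmem
      have h2 := hF c hνmem
      have h3 := hF c ht
      rw [div_div_div_eq, div_mul_div_comm, div_eq_div_iff h1.ne' (by positivity)]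
      ring
    · simp [eulerIntegral_exp_eq_zero ht]
end
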